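/- For every natural number n ≥ 2 there exists ε > 0 such that for every real H with −ε < H < 0 there exist two triples (r₁, θ₁, α₁) and (r₂, θ₂, α₂) of smooth functions ℝ → ℝ and periods L₁, L₂ > 0 with the following properties for i = 1, 2: (rᵢ, θᵢ, αᵢ) solves the CMC profile ODE system with parameter H on all of ℝ; rᵢ takes values in (0, π) and θᵢ takes values in (0, π/2); rᵢ and θᵢ are Lᵢ-periodic; the plane curve s ↦ (rᵢ(s), θᵢ(s)) is injective on [0, Lᵢ); and the images of the two closed curves {(r₁(s), θ₁(s)) : s ∈ ℝ} and {(r₂(s), θ₂(s)) : s ∈ ℝ} are distinct subsets of ℝ². -/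

import Mathlib

open Real Set

/-- The inverse cotangent, with values in `(0, π)`. -/
noncomputable def arccot (x : ℝ) : ℝ := Real.pi / 2 - Real.arctan x

/-- Right-hand side of the `α`-equation of the CMC profile ODE system:
`α̇ = (2n−2)·cot(2θ)·cos α / sin r − (2n−1)·cot r · sin α + H`. -/
noncomputable def alphaRHS (n : ℕ) (H rv θv αv : ℝ) : ℝ :=
  (2 * (n : ℝ) - 2) * (Real.cos (2 * θv) / Real.sin (2 * θv)) * Real.cos αv / Real.sin rv
    - (2 * (n : ℝ) - 1) * (Real.cos rv / Real.sin rv) * Real.sin αv + H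

/-- `(r, θ, α)` is a solution of the CMC profile ODE system on the set `I`:
the three functions are differentiable on `I`, `sin (r s) ≠ 0` and `sin (2 θ s) ≠ 0`
on `I`, and the equations `ṙ = cos α`, `θ̇ = sin α / sin r`,
`α̇ = (2n−2)·cot(2θ)·cos α / sin r − (2n−1)·cot r·sin α + H` hold at every `s ∈ I`. -/
def IsCMCSolutionOn (n : ℕ) (H : ℝ) (r θ α : ℝ → ℝ) (I : Set ℝ) : Prop :=
  ∀ s ∈ I,
    Real.sin (r s) ≠ 0 ∧ Real.sin (2 * θ s) ≠ 0 ∧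
    HasDerivWithinAt r (Real.cos (α s)) I s ∧
    HasDerivWithinAt θ (Real.sin (α s) / Real.sin (r s)) I s ∧
    HasDerivWithinAt α (alphaRHS n H (r s) (θ s) (α s)) I s
/-! ### Part A: the truncated ODE system, existence, uniqueness, dependence on parameters -/

/-- bounded Lipschitz functions -/
def BLip (f : ℝ × ℝ × ℝ → ℝ) : Prop :=
  ∃ K M : ℝ, (∀ q, |f q| ≤ M) ∧ ∀ q q', |f q - f q'| ≤ K * dist q q'

lemma BLip.mul {f g : ℝ × ℝ × ℝ → ℝ} (hf : BLip f) (hg : BLip g) : BLip (fun q => f q * g q) := by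
  obtain ⟨K, M, h1, h2⟩ := hf
  obtain ⟨K', M', h1', h2'⟩ := hg
  refine ⟨M * K' + M' * K, M * M', fun q => ?_, fun q q' => ?_⟩
  · rw [abs_mul]
    exact mul_le_mul (h1 q) (h1' q) (abs_nonneg _) ((abs_nonneg _).trans (h1 q))
  · have e : f q * g q - f q' * g q' = f q * (g q - g q') + g q' * (f q - f q') := by ring
    rw [e]
    refine (abs_add_le _ _).trans ?_
    rw [abs_mul, abs_mul]
    have a1 : |f q| * |g q - g q'| ≤ M * (K' * dist q q') :=
      mul_le_mul (h1 q) (h2' q q') (abs_nonneg _) ((abs_nonneg _).trans (h1 q))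
    have a2 : |g q'| * |f q - f q'| ≤ M' * (K * dist q q') :=
      mul_le_mul (h1' q') (h2 q q') (abs_nonneg _) ((abs_nonneg _).trans (h1' q))
    linarith

lemma BLip.add {f g : ℝ × ℝ × ℝ → ℝ} (hf : BLip f) (hg : BLip g) : BLip (fun q => f q + g q) := by
  obtain ⟨K, M, h1, h2⟩ := hf
  obtain ⟨K', M', h1', h2'⟩ := hg
  refine ⟨K + K', M + M', fun q => ?_, fun q q' => ?_⟩
  · exact (abs_add_le _ _).trans (add_le_add (h1 q) (h1' q))
  · have e : f q + g q - (f q' + g q') = (f q - f q') + (g q - g q') := by ring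
    rw [e]
    refine (abs_add_le _ _).trans ?_
    have := h2 q q'
    have := h2' q q'
    linarith

lemma BLip.const (a : ℝ) : BLip (fun _ => a) :=
  ⟨0, |a|, fun _ => le_rfl, fun q q' => by simp⟩

lemma BLip.sin {f : ℝ × ℝ × ℝ → ℝ} {K : ℝ} (hf : ∀ q q', |f q - f q'| ≤ K * dist q q') :
    BLip (fun q => Real.sin (f q)) :=
  ⟨K, 1, fun _ => Real.abs_sin_le_one _, fun q q' => (abs_sin_sub_sin_le _ _).trans (hf q q')⟩

lemma BLip.cos {f : ℝ × ℝ × ℝ → ℝ} {K : ℝ} (hf : ∀ q q', |f q - f q'| ≤ K * dist q q') :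
    BLip (fun q => Real.cos (f q)) :=
  ⟨K, 1, fun _ => Real.abs_cos_le_one _, fun q q' => (abs_cos_sub_cos_le _ _).trans (hf q q')⟩

lemma BLip.invmax {f : ℝ × ℝ × ℝ → ℝ} (hf : BLip f) {c : ℝ} (hc : 0 < c) :
    BLip (fun q => (max (f q) c)⁻¹) := by
  obtain ⟨K, M, h1, h2⟩ := hf
  have pos : ∀ q, 0 < max (f q) c := fun q => lt_of_lt_of_le hc (le_max_right _ _)
  refine ⟨c⁻¹ * c⁻¹ * K, c⁻¹, fun q => ?_, fun q q' => ?_⟩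
  · rw [abs_of_pos (inv_pos.mpr (pos q))]
    exact inv_anti₀ hc (le_max_right _ _)
  · have hp := pos q
    have hp' := pos q'
    have e : (max (f q) c)⁻¹ - (max (f q') c)⁻¹
        = (max (f q) c)⁻¹ * (max (f q') c)⁻¹ * (max (f q') c - max (f q) c) := by
      field_simp
    rw [e, abs_mul, abs_mul, abs_of_pos (inv_pos.mpr hp), abs_of_pos (inv_pos.mpr hp')]
    have i1 : (max (f q) c)⁻¹ ≤ c⁻¹ := inv_anti₀ hc (le_max_right _ _)
    have i2 : (max (f q') c)⁻¹ ≤ c⁻¹ := inv_anti₀ hc (le_max_right _ _)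
    have i3 : |max (f q') c - max (f q) c| ≤ K * dist q q' := by
      refine (abs_max_sub_max_le_abs _ _ _).trans ?_
      rw [abs_sub_comm]
      exact h2 q q'
    have j : (max (f q) c)⁻¹ * (max (f q') c)⁻¹ ≤ c⁻¹ * c⁻¹ :=
      mul_le_mul i1 i2 (inv_pos.mpr hp').le (inv_pos.mpr hc).le
    calc _ ≤ c⁻¹ * c⁻¹ * (K * dist q q') :=
          mul_le_mul j i3 (abs_nonneg _) (by positivity)
      _ = _ := by ring

/-- truncated angular equation -/
noncomputable def aR (p : ℕ) (c H x y a : ℝ) : ℝ :=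
  (-(2 * (p : ℝ))) * (Real.sin (2 * y) * (max (Real.cos (2 * y)) c)⁻¹) *
      (Real.cos a * (max (Real.cos x) c)⁻¹)
    + (2 * (p : ℝ) + 1) * (Real.sin x * (max (Real.cos x) c)⁻¹) * Real.sin a + H

noncomputable def VF (p : ℕ) (c H : ℝ) (q : ℝ × ℝ × ℝ) : ℝ × ℝ × ℝ :=
  (Real.cos q.2.2, Real.sin q.2.2 * (max (Real.cos q.1) c)⁻¹, aR p c H q.1 q.2.1 q.2.2)

lemma dist1 (q q' : ℝ × ℝ × ℝ) : |q.1 - q'.1| ≤ 1 * dist q q' := by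
  rw [one_mul, Prod.dist_eq, ← Real.dist_eq]; exact le_max_left _ _

lemma dist2 (q q' : ℝ × ℝ × ℝ) : |q.2.1 - q'.2.1| ≤ 1 * dist q q' := by
  rw [one_mul, Prod.dist_eq, Prod.dist_eq, ← Real.dist_eq]
  exact le_max_of_le_right (le_max_left _ _)

lemma dist2' (q q' : ℝ × ℝ × ℝ) : |2 * q.2.1 - 2 * q'.2.1| ≤ 2 * dist q q' := by
  have := dist2 q q'
  rw [← mul_sub, abs_mul, abs_of_pos (by norm_num : (0:ℝ) < 2)]
  linarith

lemma dist3 (q q' : ℝ × ℝ × ℝ) : |q.2.2 - q'.2.2| ≤ 1 * dist q q' := by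
  rw [one_mul, Prod.dist_eq, Prod.dist_eq, ← Real.dist_eq]
  exact le_max_of_le_right (le_max_right _ _)

lemma VF_lip (p : ℕ) {c : ℝ} (hc : 0 < c) (H : ℝ) :
    ∃ K M : NNReal, LipschitzWith K (VF p c H) ∧ ∀ q, ‖VF p c H q‖ ≤ M := by
  have b1 : BLip (fun q => (VF p c H q).1) := BLip.cos dist3
  have ix : BLip (fun q : ℝ × ℝ × ℝ => (max (Real.cos q.1) c)⁻¹) := (BLip.cos dist1).invmax hc
  have b2 : BLip (fun q => (VF p c H q).2.1) := (BLip.sin dist3).mul ix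
  have b3 : BLip (fun q => (VF p c H q).2.2) := by
    have := ((((BLip.const (-(2 * (p : ℝ)))).mul
      ((BLip.sin dist2').mul ((BLip.cos dist2').invmax hc))).mul
        ((BLip.cos dist3).mul ix)).add
      (((BLip.const (2 * (p : ℝ) + 1)).mul ((BLip.sin dist1).mul ix)).mul
        (BLip.sin dist3))).add (BLip.const H)
    exact this
  obtain ⟨K1, M1, h1, l1⟩ := b1
  obtain ⟨K2, M2, h2, l2⟩ := b2
  obtain ⟨K3, M3, h3, l3⟩ := b3
  have m0 : 0 ≤ max M1 (max M2 M3) := le_max_of_le_left ((abs_nonneg _).trans (h1 0))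
  refine ⟨⟨max 0 (max K1 (max K2 K3)), le_max_left _ _⟩, ⟨max M1 (max M2 M3), m0⟩, ?_, ?_⟩
  · refine LipschitzWith.of_dist_le_mul fun q q' => ?_
    rw [Prod.dist_eq, Prod.dist_eq, Real.dist_eq, Real.dist_eq, Real.dist_eq]
    have d := dist_nonneg (x := q) (y := q')
    refine max_le ?_ (max_le ?_ ?_)
    · exact (l1 q q').trans (mul_le_mul_of_nonneg_right
        (le_max_of_le_right (le_max_left _ _)) d)
    · exact (l2 q q').trans (mul_le_mul_of_nonneg_right
        (le_max_of_le_right (le_max_of_le_right (le_max_left _ _))) d)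
    · exact (l3 q q').trans (mul_le_mul_of_nonneg_right
        (le_max_of_le_right (le_max_of_le_right (le_max_right _ _))) d)
  · intro q
    rw [Prod.norm_def, Prod.norm_def]
    simp only [Real.norm_eq_abs]
    exact max_le (le_max_of_le_left (h1 q))
      (le_max_of_le_right (max_le_max (h2 q) (h3 q)))

/-- Global existence for a bounded Lipschitz field. -/
lemma global_exists {V : ℝ × ℝ × ℝ → ℝ × ℝ × ℝ} {K M : NNReal} (hK : LipschitzWith K V)
    (hM : ∀ q, ‖V q‖ ≤ M) (q₀ : ℝ × ℝ × ℝ) :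
    ∃ γ : ℝ → ℝ × ℝ × ℝ, γ 0 = q₀ ∧ ∀ t, HasDerivAt γ (V (γ t)) t := by
  have loc : ∀ N : ℕ, ∃ γ : ℝ → ℝ × ℝ × ℝ, γ 0 = q₀ ∧
      ∀ t ∈ Ioo (-((N : ℝ) + 1)) ((N : ℝ) + 1), HasDerivAt γ (V (γ t)) t := by
    intro N
    have h0 : (0 : ℝ) ∈ Icc (-((N : ℝ) + 1)) ((N : ℝ) + 1) := by
      constructor <;> [skip; skip] <;> have : (0:ℝ) ≤ N := Nat.cast_nonneg N <;> linarith
    have pl : IsPicardLindelof (fun _ => V) (⟨0, h0⟩ : Icc (-((N : ℝ) + 1)) ((N : ℝ) + 1)) q₀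
        (M * ((N : NNReal) + 1)) 0 M K := by
      refine IsPicardLindelof.of_time_independent (fun x _ => hM x) hK.lipschitzOnWith ?_
      simp
    obtain ⟨γ, g0, hg⟩ := pl.exists_eq_forall_mem_Icc_hasDerivWithinAt₀
    refine ⟨γ, g0, fun t ht => ?_⟩
    exact (hg t (Ioo_subset_Icc_self ht)).hasDerivAt (Icc_mem_nhds ht.1 ht.2)
  choose γ g0 hγ using loc
  have agree : ∀ N N' : ℕ, N ≤ N' → EqOn (γ N) (γ N') (Ioo (-((N : ℝ) + 1)) ((N : ℝ) + 1)) := by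
    intro N N' hN
    have hc : (N : ℝ) ≤ N' := Nat.cast_le.mpr hN
    have hn : (0:ℝ) ≤ N := Nat.cast_nonneg N
    refine ODE_solution_unique_of_mem_Ioo (v := fun _ => V) (s := fun _ => univ) (K := K) (t₀ := 0)
      (fun t _ => hK.lipschitzOnWith) ⟨by linarith, by linarith⟩
      (fun t ht => ⟨hγ N t ht, mem_univ _⟩)
      (fun t ht => ⟨hγ N' t ⟨by linarith [ht.1], by linarith [ht.2]⟩, mem_univ _⟩) ?_
    rw [g0, g0]
  refine ⟨fun t => γ (⌈|t|⌉₊) t, ?_, fun t => ?_⟩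
  · simp [g0]
  · set N := ⌈|t|⌉₊ + 1 with hN
    have ht : |t| < (N : ℝ) := by
      have := Nat.le_ceil |t|
      rw [hN]; push_cast; linarith
    have key : ∀ u : ℝ, |u| < N → γ (⌈|u|⌉₊) u = γ N u := by
      intro u hu
      have h1 : ⌈|u|⌉₊ ≤ N := Nat.ceil_le.mpr hu.le
      refine agree _ _ h1 ?_
      have h2 := Nat.le_ceil |u|
      rw [mem_Ioo, ← abs_lt]; linarith
    have h3 : HasDerivAt (γ N) (V (γ N t)) t := by
      refine hγ N t ?_
      rw [mem_Ioo, ← abs_lt]; linarith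
    have h4 : (fun t => γ (⌈|t|⌉₊) t) =ᶠ[nhds t] γ N := by
      have : ∀ᶠ u : ℝ in nhds t, |u| < (N : ℝ) := continuous_abs.continuousAt.eventually (gt_mem_nhds ht)
      filter_upwards [this] with u hu using key u hu
    show HasDerivAt _ (V (γ (⌈|t|⌉₊) t)) t
    rw [key t ht]
    exact h3.congr_of_eventuallyEq h4

/-- Solutions of the truncated system. -/
structure Sol (p : ℕ) (c H : ℝ) (x y a : ℝ → ℝ) : Prop where
  dx : ∀ s, HasDerivAt x (Real.cos (a s)) s
  dy : ∀ s, HasDerivAt y (Real.sin (a s) * (max (Real.cos (x s)) c)⁻¹) s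
  da : ∀ s, HasDerivAt a (aR p c H (x s) (y s) (a s)) s

lemma Sol.vf {p : ℕ} {c H : ℝ} {x y a : ℝ → ℝ} (h : Sol p c H x y a) (s : ℝ) :
    HasDerivAt (fun s => (x s, y s, a s)) (VF p c H (x s, y s, a s)) s :=
  (h.dx s).prodMk ((h.dy s).prodMk (h.da s))

lemma Sol.exists (p : ℕ) {c : ℝ} (hc : 0 < c) (H x₀ y₀ a₀ : ℝ) :
    ∃ x y a : ℝ → ℝ, Sol p c H x y a ∧ x 0 = x₀ ∧ y 0 = y₀ ∧ a 0 = a₀ := by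
  obtain ⟨K, M, hK, hM⟩ := VF_lip p hc H
  obtain ⟨γ, g0, hg⟩ := global_exists hK hM (x₀, y₀, a₀)
  refine ⟨fun s => (γ s).1, fun s => (γ s).2.1, fun s => (γ s).2.2, ⟨fun s => ?_, fun s => ?_,
    fun s => ?_⟩, by simp [g0], by simp [g0], by simp [g0]⟩
  · exact (hasFDerivAt_fst.comp_hasDerivAt s (hg s))
  · exact (hasFDerivAt_fst.comp_hasDerivAt s (hasFDerivAt_snd.comp_hasDerivAt s (hg s)))
  · exact (hasFDerivAt_snd.comp_hasDerivAt s (hasFDerivAt_snd.comp_hasDerivAt s (hg s)))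

lemma Sol.unique {p : ℕ} {c H : ℝ} (hc : 0 < c) {x y a x' y' a' : ℝ → ℝ} (h : Sol p c H x y a)
    (h' : Sol p c H x' y' a') (t : ℝ) (hx : x t = x' t) (hy : y t = y' t) (ha : a t = a' t) :
    ∀ s, x s = x' s ∧ y s = y' s ∧ a s = a' s := by
  obtain ⟨K, M, hK, hM⟩ := VF_lip p hc H
  have := ODE_solution_unique_univ (v := fun _ => VF p c H) (s := fun _ => univ) (K := K)
    (t₀ := t) (f := fun s => (x s, y s, a s)) (g := fun s => (x' s, y' s, a' s))
    (fun t => hK.lipschitzOnWith) (fun s => ⟨h.vf s, mem_univ _⟩) (fun s => ⟨h'.vf s, mem_univ _⟩)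
    (by simp [hx, hy, ha])
  intro s
  have e := congrFun this s
  simpa using e

/-- Continuous dependence on initial height and parameter. -/
lemma Sol.cont (p : ℕ) {c : ℝ} (hc : 0 < c) (H : ℝ) (T η : ℝ) (hη : 0 < η) :
    ∃ δ > 0, ∀ x y a x' y' a' : ℝ → ℝ, ∀ H', Sol p c H x y a → Sol p c H' x' y' a' →
      |H' - H| ≤ δ → x 0 = x' 0 → |y 0 - y' 0| ≤ δ → a 0 = a' 0 →
      ∀ s ∈ Icc 0 T, |x s - x' s| < η ∧ |y s - y' s| < η ∧ |a s - a' s| < η := by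
  obtain ⟨K, M, hK, hM⟩ := VF_lip p hc H
  have hc2 : Continuous fun δ => gronwallBound δ K (0 + δ) T := by
    by_cases hk : (K : ℝ) = 0
    · simp only [gronwallBound_K0, hk]; fun_prop
    · simp only [gronwallBound_of_K_ne_0 hk]; fun_prop
  have h0 : gronwallBound 0 K (0 + 0) T = 0 := by rw [add_zero, gronwallBound_ε0_δ0]
  have ev : ∀ᶠ δ in nhdsWithin (0:ℝ) (Ioi 0), gronwallBound δ K (0 + δ) T < η := by
    have : ∀ᶠ δ in nhds (0:ℝ), gronwallBound δ K (0 + δ) T < η := by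
      refine hc2.continuousAt.eventually (gt_mem_nhds ?_)
      simpa only [h0] using hη
    exact this.filter_mono nhdsWithin_le_nhds
  obtain ⟨δ, hδ, hpos⟩ := (ev.and self_mem_nhdsWithin).exists
  have hpos : 0 < δ := hpos
  refine ⟨δ, hpos, fun x y a x' y' a' H' h h' hH hx hy ha s hs => ?_⟩
  have := dist_le_of_approx_trajectories_ODE (v := fun _ => VF p c H) (K := K) (a := 0) (b := T)
    (f := fun s => (x s, y s, a s)) (g := fun s => (x' s, y' s, a' s)) (δ := δ)
    (f' := fun s => VF p c H (x s, y s, a s)) (g' := fun s => VF p c H' (x' s, y' s, a' s))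
    (εf := 0) (εg := δ)
    (fun t => hK) (fun s _ => (h.vf s).continuousAt.continuousWithinAt)
    (fun s _ => (h.vf s).hasDerivWithinAt) (fun s _ => by simp)
    (fun s _ => (h'.vf s).continuousAt.continuousWithinAt)
    (fun s _ => (h'.vf s).hasDerivWithinAt)
    (fun s _ => by
      simp only [VF, aR, Prod.dist_eq, dist_self, Real.dist_eq]
      simp only [add_sub_add_left_eq_sub]
      simp [hH])
    (by simp only [Prod.dist_eq, Real.dist_eq, hx, ha]; simp [hy]) s hs
  have m := gronwallBound_mono (δ := δ) (K := K) (ε := 0 + δ) hpos.le (by linarith) K.2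
    (show s - 0 ≤ T by linarith [hs.2])
  have l := lt_of_le_of_lt (this.trans m) hδ
  simp only [Prod.dist_eq, Real.dist_eq, max_lt_iff] at l
  exact l
/-! ### Part B: monotonicity helpers and the exit lemma -/

lemma lower_hd {f f' : ℝ → ℝ} {a b k : ℝ} (hab : a ≤ b)
    (h : ∀ s ∈ Icc a b, HasDerivAt f (f' s) s) (h0 : ∀ s ∈ Icc a b, k ≤ f' s) :
    f a + k * (b - a) ≤ f b := by
  have hg : ∀ s ∈ Icc a b, HasDerivAt (fun s => f s - k * s) (f' s - k * 1) s :=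
    fun s hs => (h s hs).sub ((hasDerivAt_id s).const_mul k)
  have m : MonotoneOn (fun s => f s - k * s) (Icc a b) := by
    refine monotoneOn_of_deriv_nonneg (convex_Icc a b)
      (fun s hs => (hg s hs).continuousAt.continuousWithinAt)
      (fun s hs => (hg s (interior_subset hs)).differentiableAt.differentiableWithinAt) ?_
    intro s hs
    rw [(hg s (interior_subset hs)).deriv]
    have := h0 s (interior_subset hs)
    linarith
  have := m (left_mem_Icc.mpr hab) (right_mem_Icc.mpr hab) hab
  simp only at this
  linarith

lemma upper_hd {f f' : ℝ → ℝ} {a b k : ℝ} (hab : a ≤ b)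
    (h : ∀ s ∈ Icc a b, HasDerivAt f (f' s) s) (h0 : ∀ s ∈ Icc a b, f' s ≤ k) :
    f b ≤ f a + k * (b - a) := by
  have := lower_hd (f := fun s => - f s) (f' := fun s => - f' s) (k := -k) hab
    (fun s hs => (h s hs).neg) (fun s hs => neg_le_neg (h0 s hs))
  linarith

lemma mono_hd {f f' : ℝ → ℝ} {a b : ℝ} (hab : a ≤ b)
    (h : ∀ s ∈ Icc a b, HasDerivAt f (f' s) s) (h0 : ∀ s ∈ Icc a b, 0 ≤ f' s) :
    f a ≤ f b := by
  have := lower_hd (k := 0) hab h h0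
  linarith

lemma anti_hd {f f' : ℝ → ℝ} {a b : ℝ} (hab : a ≤ b)
    (h : ∀ s ∈ Icc a b, HasDerivAt f (f' s) s) (h0 : ∀ s ∈ Icc a b, f' s ≤ 0) :
    f b ≤ f a := by
  have := upper_hd (k := 0) hab h h0
  linarith

lemma strict_hd {f f' : ℝ → ℝ} {a b : ℝ} (hab : a < b)
    (h : ∀ s ∈ Icc a b, HasDerivAt f (f' s) s) (h0 : ∀ s ∈ Ioo a b, 0 < f' s) :
    f a < f b := by
  have m : StrictMonoOn f (Icc a b) := by
    refine strictMonoOn_of_deriv_pos (convex_Icc a b)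
      (fun s hs => (h s hs).continuousAt.continuousWithinAt) ?_
    intro s hs
    rw [(h s (interior_subset hs)).deriv]
    rw [interior_Icc] at hs
    exact h0 s hs
  exact m (left_mem_Icc.mpr hab.le) (right_mem_Icc.mpr hab.le) hab

/-- the honest angular equation in centred coordinates -/
noncomputable def aT (p : ℕ) (H x y a : ℝ) : ℝ :=
  -(2 * (p : ℝ)) * (Real.sin (2 * y) / Real.cos (2 * y)) * (Real.cos a / Real.cos x)
    + (2 * (p : ℝ) + 1) * (Real.sin x / Real.cos x) * Real.sin a + H

lemma aR_eq {p : ℕ} {c H x y a : ℝ} (hx : c ≤ Real.cos x) (hy : c ≤ Real.cos (2 * y)) :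
    aR p c H x y a = aT p H x y a := by
  unfold aR aT
  rw [max_eq_left hx, max_eq_left hy]
  ring

/-- derivative of the first flux -/
lemma flux1 {p : ℕ} {H : ℝ} {x y a : ℝ → ℝ} {s : ℝ} (hx : HasDerivAt x (Real.cos (a s)) s)
    (ha : HasDerivAt a (aT p H (x s) (y s) (a s)) s) (hc : Real.cos (x s) ≠ 0) :
    HasDerivAt (fun s => Real.cos (x s) ^ (2 * p + 1) * Real.sin (a s))
      (Real.cos (x s) ^ (2 * p) * Real.cos (a s) *
        (-(2 * (p : ℝ)) * (Real.sin (2 * y s) / Real.cos (2 * y s)) * Real.cos (a s)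
          + H * Real.cos (x s))) s := by
  have h := ((hx.cos).pow (2 * p + 1)).mul ha.sin
  refine h.congr_deriv ?_
  unfold aT
  simp only [Nat.add_sub_cancel, Pi.pow_apply]
  push_cast
  generalize Real.sin (2 * y s) / Real.cos (2 * y s) = w
  field_simp
  ring

/-- derivative of the second flux -/
lemma flux2 {p : ℕ} (hp : 1 ≤ p) {H : ℝ} {x y a : ℝ → ℝ} {s : ℝ}
    (hy : HasDerivAt y (Real.sin (a s) / Real.cos (x s)) s)
    (ha : HasDerivAt a (aT p H (x s) (y s) (a s)) s) (hc : Real.cos (x s) ≠ 0)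
    (hcy : Real.cos (2 * y s) ≠ 0) :
    HasDerivAt (fun s => Real.cos (2 * y s) ^ p * Real.cos (a s))
      (- Real.cos (2 * y s) ^ p * Real.sin (a s) *
        ((2 * (p : ℝ) + 1) * (Real.sin (x s) / Real.cos (x s)) * Real.sin (a s) + H)) s := by
  obtain ⟨k, rfl⟩ : ∃ k, p = k + 1 := ⟨p - 1, by omega⟩
  have h := (((hy.const_mul 2).cos).pow (k + 1)).mul ha.cos
  refine h.congr_deriv ?_
  unfold aT
  simp only [Nat.add_sub_cancel, Pi.pow_apply]
  push_cast
  field_simp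
  ring

structure Arc (p : ℕ) (c H b : ℝ) (x y a : ℝ → ℝ) (T : ℝ) : Prop where
  pos : 0 < T
  x0 : x 0 = 0
  y0 : y 0 = -b
  a0 : a 0 = 0
  dx : ∀ s ∈ Icc 0 T, HasDerivAt x (Real.cos (a s)) s
  dy : ∀ s ∈ Icc 0 T, HasDerivAt y (Real.sin (a s) / Real.cos (x s)) s
  da : ∀ s ∈ Icc 0 T, HasDerivAt a (aT p H (x s) (y s) (a s)) s
  hy : ∀ s ∈ Icc 0 T, y s ≤ 0
  hyb : ∀ s ∈ Icc 0 T, -b ≤ y s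
  ha : ∀ s ∈ Ioc 0 T, 0 < a s
  ha' : ∀ s ∈ Icc 0 T, a s ≤ Real.pi / 2
  hx : ∀ s ∈ Icc 0 T, 0 ≤ x s
  hx' : ∀ s ∈ Icc 0 T, x s < Real.pi / 2
  hcx : ∀ s ∈ Icc 0 T, c ≤ Real.cos (x s)
  hcy : ∀ s ∈ Icc 0 T, c ≤ Real.cos (2 * y s)
  hda : ∀ s ∈ Icc 0 T, 0 < aT p H (x s) (y s) (a s)

lemma half_le_cos {u : ℝ} (h0 : 0 ≤ u) (h1 : u ≤ 1) : 1 / 2 ≤ Real.cos u := by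
  rw [← Real.cos_pi_div_three]
  refine Real.cos_le_cos_of_nonneg_of_le_pi h0 (by linarith [Real.pi_pos]) ?_
  linarith [Real.pi_gt_three]

/-- facts valid on an interval on which the weak constraints hold -/
structure Facts (p : ℕ) (b c H κ τ Tm : ℝ) (x y a : ℝ → ℝ) (t : ℝ) : Prop where
  le : t ≤ Tm
  x_nn : ∀ s ∈ Icc 0 t, 0 ≤ x s
  y_b : ∀ s ∈ Icc 0 t, -b ≤ y s
  cy : ∀ s ∈ Icc 0 t, c ≤ Real.cos (2 * y s)
  cx : ∀ s ∈ Icc 0 t, c < Real.cos (x s)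
  a_nn : ∀ s ∈ Icc 0 t, 0 ≤ a s
  a_gt : ∀ s ∈ Ioc 0 t, κ * min s τ < a s
  da0 : ∀ s ∈ Icc 0 t, 0 < aT p H (x s) (y s) (a s)
  da1 : 2 * κ ≤ aT p H (x 0) (y 0) (a 0)

set_option maxHeartbeats 1000000 in
lemma inner {p : ℕ} (hp : 1 ≤ p) {b1 b2 b c ε H τ κ μ M Tm f0 t : ℝ} {x y a : ℝ → ℝ}
    (hb1 : 0 < b1) (hb1b : b1 ≤ b) (hbb2 : b ≤ b2) (hb2 : b2 < Real.pi / 4)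
    (hM : M = 2 * p * (1 / Real.cos (2 * b2)) * 2 + (2 * p + 1) * 2 + 1)
    (hτ0 : 0 < τ) (hτ1 : τ ≤ b1 / 4) (hτM : M * τ ≤ 1) (hκ : κ = b1 / 4)
    (hμ : μ = Real.sin (τ / 2) * Real.sin (κ * τ) / 2) (hμ0 : 0 < μ) (hTm : Tm = τ + 2 / μ)
    (hf0 : f0 = (1 / 2) ^ (2 * p + 1) * Real.sin (κ * τ)) (hf00 : 0 < f0)
    (hε1 : ε ≤ b1 / 2) (hεμ : ε ≤ μ) (hεf : ε * Tm ≤ f0 / 2) (hε2 : ε ≤ 1)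
    (hc0 : 0 < c) (hcf : c ≤ f0 / 4) (hcb : c ≤ Real.cos (2 * b2)) (hH : |H| ≤ ε)
    (hS : Sol p c H x y a) (hx0 : x 0 = 0) (hy0 : y 0 = -b) (ha0 : a 0 = 0) (ht : 0 ≤ t)
    (g1 : ∀ s ∈ Icc 0 t, y s ≤ 0) (g2 : ∀ s ∈ Icc 0 t, κ * min s τ ≤ a s)
    (g3 : ∀ s ∈ Icc 0 t, a s ≤ Real.pi / 2) (g4 : ∀ s ∈ Icc 0 t, x s ≤ Real.pi / 2)
    (g5 : ∀ s ∈ Icc 0 t, c ≤ Real.cos (x s)) : Facts p b c H κ τ Tm x y a t := by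
  have pi4 := Real.pi_lt_four
  have pi3 := Real.pi_gt_three
  have hp1 : (1 : ℝ) ≤ p := by exact_mod_cast hp
  have hHl : -ε ≤ H := (abs_le.mp hH).1
  have hHu : H ≤ ε := (abs_le.mp hH).2
  have hε0 : 0 ≤ ε := (abs_nonneg H).trans hH
  have hκ0 : 0 < κ := by rw [hκ]; linarith
  have hb2c : 0 < Real.cos (2 * b2) := lt_of_lt_of_le hc0 hcb
  have hτle : τ ≤ 1 := by linarith
  have sub : ∀ {s}, s ∈ Icc 0 t → ∀ u ∈ Icc 0 s, u ∈ Icc 0 t :=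
    fun hs u hu => ⟨hu.1, hu.2.trans hs.2⟩
  have ann : ∀ s ∈ Icc 0 t, 0 ≤ a s := fun s hs =>
    (mul_nonneg hκ0.le (le_min hs.1 hτ0.le)).trans (g2 s hs)
  have csa : ∀ s ∈ Icc 0 t, 0 ≤ Real.cos (a s) := fun s hs =>
    Real.cos_nonneg_of_mem_Icc ⟨by linarith [ann s hs], g3 s hs⟩
  have sna : ∀ s ∈ Icc 0 t, 0 ≤ Real.sin (a s) := fun s hs =>
    Real.sin_nonneg_of_nonneg_of_le_pi (ann s hs) (by linarith [g3 s hs])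
  have xnn : ∀ s ∈ Icc 0 t, 0 ≤ x s := fun s hs => by
    have := mono_hd hs.1 (fun u _ => hS.dx u) (fun u hu => csa u (sub hs u hu))
    rwa [hx0] at this
  have xle : ∀ s ∈ Icc 0 t, x s ≤ s := fun s hs => by
    have := upper_hd hs.1 (fun u _ => hS.dx u) (fun u hu => Real.cos_le_one (a u))
    rw [hx0] at this; linarith
  have snx : ∀ s ∈ Icc 0 t, 0 ≤ Real.sin (x s) := fun s hs =>
    Real.sin_nonneg_of_nonneg_of_le_pi (xnn s hs) (by linarith [g4 s hs])
  have cxp : ∀ s ∈ Icc 0 t, 0 < Real.cos (x s) := fun s hs => hc0.trans_le (g5 s hs)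
  have dy : ∀ s ∈ Icc 0 t, HasDerivAt y (Real.sin (a s) / Real.cos (x s)) s := fun s hs => by
    have := hS.dy s
    rwa [max_eq_left (g5 s hs), ← div_eq_mul_inv] at this
  have yb : ∀ s ∈ Icc 0 t, -b ≤ y s := fun s hs => by
    have := mono_hd hs.1 (fun u hu => dy u (sub hs u hu))
      (fun u hu => div_nonneg (sna u (sub hs u hu)) (cxp u (sub hs u hu)).le)
    rwa [hy0] at this
  have cy2 : ∀ s ∈ Icc 0 t, Real.cos (2 * b2) ≤ Real.cos (2 * y s) := fun s hs => by
    rw [← Real.cos_neg (2 * y s)]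
    refine Real.cos_le_cos_of_nonneg_of_le_pi ?_ ?_ ?_
    · linarith [g1 s hs]
    · linarith
    · linarith [yb s hs]
  have cy : ∀ s ∈ Icc 0 t, c ≤ Real.cos (2 * y s) := fun s hs => hcb.trans (cy2 s hs)
  have cyp : ∀ s ∈ Icc 0 t, 0 < Real.cos (2 * y s) := fun s hs => hc0.trans_le (cy s hs)
  have da : ∀ s ∈ Icc 0 t, HasDerivAt a (aT p H (x s) (y s) (a s)) s := fun s hs => by
    have := hS.da s
    rwa [aR_eq (g5 s hs) (cy s hs)] at this
  have sny : ∀ s ∈ Icc 0 t, Real.sin (2 * y s) ≤ 0 := fun s hs =>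
    Real.sin_nonpos_of_nonpos_of_neg_pi_le (by linarith [g1 s hs]) (by linarith [yb s hs])
  have tany : ∀ s ∈ Icc 0 t, -(2 * y s) ≤ -(Real.sin (2 * y s) / Real.cos (2 * y s)) := by
    intro s hs
    have := Real.le_tan (x := -(2 * y s)) (by linarith [g1 s hs]) (by linarith [yb s hs])
    rw [Real.tan_eq_sin_div_cos, Real.sin_neg, Real.cos_neg, neg_div] at this
    exact this
  have tany0 : ∀ s ∈ Icc 0 t, 0 ≤ -(Real.sin (2 * y s) / Real.cos (2 * y s)) := by
    intro s hs
    linarith [tany s hs, g1 s hs]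
  -- early phase
  have cxh : ∀ s ∈ Icc 0 t, s ≤ τ → 1 / 2 ≤ Real.cos (x s) := fun s hs hsτ =>
    half_le_cos (xnn s hs) (by linarith [xle s hs])
  have yup : ∀ s ∈ Icc 0 t, s ≤ τ → y s ≤ -b1 / 2 := by
    intro s hs hsτ
    have := upper_hd (k := 2) hs.1 (fun u hu => dy u (sub hs u hu)) (fun u hu => by
      have h1 := cxh u (sub hs u hu) (hu.2.trans hsτ)
      rw [div_le_iff₀ (by linarith)]
      linarith [Real.sin_le_one (a u)])
    rw [hy0] at this
    linarith
  have aup : ∀ s ∈ Icc 0 t, s ≤ τ → a s ≤ 1 := by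
    intro s hs hsτ
    have := upper_hd (k := M) hs.1 (fun u hu => da u (sub hs u hu)) (fun u hu => by
      have hu' := sub hs u hu
      have h1 := cxh u hu' (hu.2.trans hsτ)
      have i1 : Real.cos (a u) / Real.cos (x u) ≤ 2 := by
        rw [div_le_iff₀ (by linarith)]; linarith [Real.cos_le_one (a u)]
      have i2 : Real.sin (x u) / Real.cos (x u) ≤ 2 := by
        rw [div_le_iff₀ (by linarith)]; linarith [Real.sin_le_one (x u)]
      have i2' : 0 ≤ Real.sin (x u) / Real.cos (x u) := div_nonneg (snx u hu') (cxp u hu').le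
      have i1' : 0 ≤ Real.cos (a u) / Real.cos (x u) := div_nonneg (csa u hu') (cxp u hu').le
      have i3 : -(Real.sin (2 * y u) / Real.cos (2 * y u)) ≤ 1 / Real.cos (2 * b2) := by
        rw [← neg_div]
        exact div_le_div₀ zero_le_one (by linarith [Real.neg_one_le_sin (2 * y u)]) hb2c
          (cy2 u hu')
      have i3' := tany0 u hu'
      have e : aT p H (x u) (y u) (a u) = 2 * p * (-(Real.sin (2 * y u) / Real.cos (2 * y u)))
          * (Real.cos (a u) / Real.cos (x u)) + (2 * p + 1) * (Real.sin (x u) / Real.cos (x u))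
          * Real.sin (a u) + H := by unfold aT; ring
      rw [e, hM]
      have j1 : 2 * p * (-(Real.sin (2 * y u) / Real.cos (2 * y u)))
          * (Real.cos (a u) / Real.cos (x u)) ≤ 2 * p * (1 / Real.cos (2 * b2)) * 2 := by
        gcongr
      have j2 : (2 * p + 1) * (Real.sin (x u) / Real.cos (x u)) * Real.sin (a u)
          ≤ (2 * p + 1) * 2 * 1 := by
        gcongr
        · exact sna u hu'
        · exact Real.sin_le_one _
      linarith)
    rw [ha0] at this
    have hM0 : 0 ≤ M := by rw [hM]; positivity
    have : M * s ≤ M * τ := by gcongr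
    linarith
  have cah : ∀ s ∈ Icc 0 t, s ≤ τ → 1 / 2 ≤ Real.cos (a s) := fun s hs hsτ =>
    half_le_cos (ann s hs) (aup s hs hsτ)
  have dlow1 : ∀ s ∈ Icc 0 t, s ≤ τ → 2 * κ ≤ aT p H (x s) (y s) (a s) := by
    intro s hs hsτ
    have h1 := cxp s hs
    have i1 : 1 / 2 ≤ Real.cos (a s) / Real.cos (x s) := by
      rw [le_div_iff₀ h1]
      linarith [Real.cos_le_one (x s), cah s hs hsτ]
    have i2' : 0 ≤ Real.sin (x s) / Real.cos (x s) := div_nonneg (snx s hs) (cxp s hs).le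
    have i3 : b1 ≤ -(Real.sin (2 * y s) / Real.cos (2 * y s)) := by
      linarith [tany s hs, yup s hs hsτ]
    have e : aT p H (x s) (y s) (a s) = 2 * p * (-(Real.sin (2 * y s) / Real.cos (2 * y s)))
          * (Real.cos (a s) / Real.cos (x s)) + (2 * p + 1) * (Real.sin (x s) / Real.cos (x s))
          * Real.sin (a s) + H := by unfold aT; ring
    have j1 : 2 * 1 * b1 * (1 / 2) ≤ 2 * p * (-(Real.sin (2 * y s) / Real.cos (2 * y s)))
          * (Real.cos (a s) / Real.cos (x s)) := by
      gcongr
      exact mul_nonneg (by positivity) (tany0 s hs)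
    have j2 : 0 ≤ (2 * p + 1) * (Real.sin (x s) / Real.cos (x s)) * Real.sin (a s) :=
      mul_nonneg (mul_nonneg (by positivity) i2') (sna s hs)
    rw [e, hκ]
    linarith
  have alow1 : ∀ s ∈ Icc 0 t, s ≤ τ → 2 * κ * s ≤ a s := by
    intro s hs hsτ
    have := lower_hd (k := 2 * κ) hs.1 (fun u hu => da u (sub hs u hu))
      (fun u hu => dlow1 u (sub hs u hu) (hu.2.trans hsτ))
    rw [ha0] at this
    linarith
  have xlow1 : ∀ s ∈ Icc 0 t, s ≤ τ → s / 2 ≤ x s := by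
    intro s hs hsτ
    have := lower_hd (k := 1 / 2) hs.1 (fun u _ => hS.dx u)
      (fun u hu => cah u (sub hs u hu) (hu.2.trans hsτ))
    rw [hx0] at this
    linarith
  -- late phase
  have xlow2 : ∀ s ∈ Icc 0 t, τ ≤ s → τ / 2 ≤ x s := by
    intro s hs hsτ
    have h1 := xlow1 τ ⟨hτ0.le, hsτ.trans hs.2⟩ le_rfl
    have := mono_hd hsτ (fun u _ => hS.dx u) (fun u hu => csa u ⟨hτ0.le.trans hu.1, hu.2.trans hs.2⟩)
    linarith
  have dlow2 : ∀ s ∈ Icc 0 t, τ ≤ s → μ ≤ aT p H (x s) (y s) (a s) := by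
    intro s hs hsτ
    have h1 := cxp s hs
    have i1 : 0 ≤ Real.cos (a s) / Real.cos (x s) := div_nonneg (csa s hs) h1.le
    have k1 : Real.sin (τ / 2) ≤ Real.sin (x s) :=
      Real.sin_le_sin_of_le_of_le_pi_div_two (by linarith) (g4 s hs) (xlow2 s hs hsτ)
    have k1' : 0 ≤ Real.sin (τ / 2) := Real.sin_nonneg_of_nonneg_of_le_pi (by linarith) (by linarith)
    have i2 : Real.sin (τ / 2) ≤ Real.sin (x s) / Real.cos (x s) := by
      rw [le_div_iff₀ h1]
      have := mul_le_mul_of_nonneg_left (Real.cos_le_one (x s)) k1'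
      linarith
    have kk : 0 < κ * τ := mul_pos hκ0 hτ0
    have i4 : Real.sin (κ * τ) ≤ Real.sin (a s) := by
      refine Real.sin_le_sin_of_le_of_le_pi_div_two (by linarith) (g3 s hs) ?_
      have := g2 s hs
      rwa [min_eq_right hsτ] at this
    have kle : κ * τ ≤ 1 := by rw [hκ]; nlinarith
    have i4' : 0 ≤ Real.sin (κ * τ) := Real.sin_nonneg_of_nonneg_of_le_pi kk.le (by linarith)
    have e : aT p H (x s) (y s) (a s) = 2 * p * (-(Real.sin (2 * y s) / Real.cos (2 * y s)))
          * (Real.cos (a s) / Real.cos (x s)) + (2 * p + 1) * (Real.sin (x s) / Real.cos (x s))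
          * Real.sin (a s) + H := by unfold aT; ring
    have j1 : 0 ≤ 2 * p * (-(Real.sin (2 * y s) / Real.cos (2 * y s)))
          * (Real.cos (a s) / Real.cos (x s)) :=
      mul_nonneg (mul_nonneg (by positivity) (tany0 s hs)) i1
    have j2 : 1 * Real.sin (τ / 2) * Real.sin (κ * τ) ≤
        (2 * p + 1) * (Real.sin (x s) / Real.cos (x s)) * Real.sin (a s) := by
      gcongr
      · exact mul_nonneg (by positivity) (k1'.trans i2)
      · linarith
    rw [e]
    linarith
  have dpos : ∀ s ∈ Icc 0 t, 0 < aT p H (x s) (y s) (a s) := by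
    intro s hs
    rcases le_total s τ with h | h
    · linarith [dlow1 s hs h]
    · linarith [dlow2 s hs h]
  have alow2 : ∀ s ∈ Icc 0 t, τ ≤ s → 2 * κ * τ + μ * (s - τ) ≤ a s := by
    intro s hs hsτ
    have h1 := alow1 τ ⟨hτ0.le, hsτ.trans hs.2⟩ le_rfl
    have := lower_hd (k := μ) hsτ (fun u hu => da u ⟨hτ0.le.trans hu.1, hu.2.trans hs.2⟩)
      (fun u hu => dlow2 u ⟨hτ0.le.trans hu.1, hu.2.trans hs.2⟩ hu.1)
    linarith
  have kk : 0 < κ * τ := mul_pos hκ0 hτ0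
  have tTm : t ≤ Tm := by
    rw [hTm]
    rcases le_total t τ with h | h
    · have : 0 < 2 / μ := by positivity
      linarith
    · have h1 := alow2 t ⟨ht, le_rfl⟩ h
      have h2 := g3 t ⟨ht, le_rfl⟩
      have : t - τ ≤ 2 / μ := by
        rw [le_div_iff₀ hμ0]; nlinarith
      linarith
  refine ⟨tTm, xnn, yb, cy, ?_, ann, ?_, dpos, dlow1 0 ⟨le_rfl, ht⟩ hτ0.le⟩
  · intro s hs
    have hf1 : f0 ≤ 1 / 2 := by
      rw [hf0, pow_succ]
      have q1 : ((1 : ℝ) / 2) ^ (2 * p) ≤ 1 := pow_le_one₀ (by norm_num) (by norm_num)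
      have q2 := Real.sin_le_one (κ * τ)
      have q3 : (0 : ℝ) < (1 / 2) ^ (2 * p) := by positivity
      nlinarith
    rcases le_total s τ with h | h
    · linarith [cxh s hs h]
    · have hτt : τ ∈ Icc 0 t := ⟨hτ0.le, h.trans hs.2⟩
      have sub2 : ∀ u ∈ Icc τ s, u ∈ Icc 0 t := fun u hu =>
        ⟨hτ0.le.trans hu.1, hu.2.trans hs.2⟩
      have := lower_hd (k := -ε) h (fun u hu => flux1 (hS.dx u) (da u (sub2 u hu))
        (cxp u (sub2 u hu)).ne') (fun u hu => by
          have hu' := sub2 u hu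
          have q1 : 0 ≤ Real.cos (x u) ^ (2 * p) * Real.cos (a u) :=
            mul_nonneg (by have := cxp u hu'; positivity) (csa u hu')
          have q2 : Real.cos (x u) ^ (2 * p) * Real.cos (a u) ≤ 1 :=
            mul_le_one₀ (pow_le_one₀ (cxp u hu').le (Real.cos_le_one _)) (csa u hu')
              (Real.cos_le_one _)
          have q3 : 0 ≤ -(2 * (p : ℝ)) * (Real.sin (2 * y u) / Real.cos (2 * y u))
              * Real.cos (a u) := by
            have := mul_nonneg (mul_nonneg (by positivity : (0:ℝ) ≤ 2 * p) (tany0 u hu'))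
              (csa u hu')
            linarith
          have q4 : -ε ≤ H * Real.cos (x u) := by
            have := cxp u hu'
            have := Real.cos_le_one (x u)
            nlinarith
          nlinarith)
      have f1 : f0 ≤ Real.cos (x τ) ^ (2 * p + 1) * Real.sin (a τ) := by
        rw [hf0]
        have i4 : Real.sin (κ * τ) ≤ Real.sin (a τ) := by
          refine Real.sin_le_sin_of_le_of_le_pi_div_two (by linarith) (g3 τ hτt) ?_
          have := g2 τ hτt
          rwa [min_self] at this
        have kle : κ * τ ≤ 1 := by rw [hκ]; nlinarith
        have i4' : 0 ≤ Real.sin (κ * τ) := Real.sin_nonneg_of_nonneg_of_le_pi kk.le (by linarith)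
        have := cxh τ hτt le_rfl
        gcongr
      have f2 : ε * (s - τ) ≤ ε * Tm := by
        gcongr
        linarith [hs.2]
      have f3 : Real.cos (x s) ^ (2 * p + 1) * Real.sin (a s) ≤ Real.cos (x s) := by
        rw [pow_succ]
        have q0 := cxp s hs
        have q1 : Real.cos (x s) ^ (2 * p) ≤ 1 := pow_le_one₀ q0.le (Real.cos_le_one _)
        have q2 : Real.cos (x s) ^ (2 * p) * Real.sin (a s) ≤ 1 :=
          mul_le_one₀ q1 (sna s hs) (Real.sin_le_one _)
        nlinarith
      linarith
  · intro s hs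
    have hs' : s ∈ Icc 0 t := ⟨hs.1.le, hs.2⟩
    rcases le_total s τ with h | h
    · rw [min_eq_left h]
      have := alow1 s hs' h
      have := mul_pos hκ0 hs.1
      linarith
    · rw [min_eq_right h]
      have h1 := alow2 s hs' h
      have : 0 ≤ μ * (s - τ) := mul_nonneg hμ0.le (by linarith)
      linarith
lemma continuation {P : ℝ → Prop} (hcl : IsClosed {s | P s}) (h0 : P 0) {Tm : ℝ}
    (hb : ∀ t, 0 ≤ t → (∀ s ∈ Icc 0 t, P s) → t ≤ Tm) :
    ∃ T, 0 ≤ T ∧ (∀ s ∈ Icc 0 T, P s) ∧ ¬ ∃ u, T < u ∧ ∀ s ∈ Icc T u, P s := by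
  set S : Set ℝ := {t | 0 ≤ t ∧ ∀ s ∈ Icc 0 t, P s} with hS
  have S0 : (0 : ℝ) ∈ S := ⟨le_rfl, fun s hs => by
    have : s = 0 := le_antisymm hs.2 hs.1
    rw [this]; exact h0⟩
  have Sb : BddAbove S := ⟨Tm, fun t ht => hb t ht.1 ht.2⟩
  have T0 : 0 ≤ sSup S := le_csSup Sb S0
  have hlt : ∀ s, 0 ≤ s → s < sSup S → P s := by
    intro s hs hlt
    obtain ⟨t, ht, hst⟩ := exists_lt_of_lt_csSup ⟨0, S0⟩ hlt
    exact ht.2 s ⟨hs, hst.le⟩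
  have hT : P (sSup S) := by
    rcases T0.eq_or_lt with h | h
    · rw [← h]; exact h0
    · have : sSup S ∈ closure (Ico 0 (sSup S)) := by
        rw [closure_Ico h.ne]; exact ⟨T0, le_rfl⟩
      exact hcl.closure_subset_iff.mpr (fun s hs => hlt s hs.1 hs.2) this
  have hall : ∀ s ∈ Icc 0 (sSup S), P s := by
    intro s hs
    rcases hs.2.eq_or_lt with h | h
    · rw [h]; exact hT
    · exact hlt s hs.1 h
  refine ⟨sSup S, T0, hall, ?_⟩
  rintro ⟨u, hu, hP⟩
  have : u ∈ S := ⟨T0.trans hu.le, fun s hs => by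
    rcases le_total s (sSup S) with h | h
    · exact hall s ⟨hs.1, h⟩
    · exact hP s ⟨h, hs.2⟩⟩
  exact absurd (le_csSup Sb this) (not_le.mpr hu)

lemma Sol.contx {p : ℕ} {c H : ℝ} {x y a : ℝ → ℝ} (h : Sol p c H x y a) : Continuous x :=
  continuous_iff_continuousAt.mpr fun s => (h.dx s).continuousAt
lemma Sol.conty {p : ℕ} {c H : ℝ} {x y a : ℝ → ℝ} (h : Sol p c H x y a) : Continuous y :=
  continuous_iff_continuousAt.mpr fun s => (h.dy s).continuousAt
lemma Sol.conta {p : ℕ} {c H : ℝ} {x y a : ℝ → ℝ} (h : Sol p c H x y a) : Continuous a :=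
  continuous_iff_continuousAt.mpr fun s => (h.da s).continuousAt

/-- Exit lemma: solutions starting at the bottom of the lens reach the axis or become vertical. -/
lemma exit_lemma {p : ℕ} (hp : 1 ≤ p) {b1 b2 : ℝ} (hb1 : 0 < b1) (hb12 : b1 ≤ b2)
    (hb2 : b2 < Real.pi / 4) :
    ∃ c > 0, ∃ ε > 0, ∀ H b : ℝ, |H| ≤ ε → b1 ≤ b → b ≤ b2 → ∀ x y a : ℝ → ℝ,
      Sol p c H x y a → x 0 = 0 → y 0 = -b → a 0 = 0 →
      ∃ T, Arc p c H b x y a T ∧ (y T = 0 ∨ a T = Real.pi / 2) := by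
  have pi4 := Real.pi_lt_four
  have pi3 := Real.pi_gt_three
  have hb2c : 0 < Real.cos (2 * b2) := Real.cos_pos_of_mem_Ioo ⟨by linarith, by linarith⟩
  obtain ⟨M, hM⟩ : ∃ M : ℝ, M = 2 * p * (1 / Real.cos (2 * b2)) * 2 + (2 * p + 1) * 2 + 1 :=
    ⟨_, rfl⟩
  have hM0 : 0 < M := by rw [hM]; positivity
  obtain ⟨τ, hτ⟩ : ∃ τ : ℝ, τ = min (b1 / 4) (1 / M) := ⟨_, rfl⟩
  have hτ0 : 0 < τ := by rw [hτ]; exact lt_min (by linarith) (by positivity)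
  have hτ1 : τ ≤ b1 / 4 := by rw [hτ]; exact min_le_left _ _
  have hτM : M * τ ≤ 1 := by
    have : τ ≤ 1 / M := by rw [hτ]; exact min_le_right _ _
    rw [le_div_iff₀ hM0] at this
    linarith
  obtain ⟨κ, hκ⟩ : ∃ κ : ℝ, κ = b1 / 4 := ⟨_, rfl⟩
  have hκ0 : 0 < κ := by rw [hκ]; linarith
  have kk : 0 < κ * τ := mul_pos hκ0 hτ0
  have kle : κ * τ ≤ 1 := by rw [hκ]; nlinarith
  have sk : 0 < Real.sin (κ * τ) := Real.sin_pos_of_pos_of_lt_pi kk (by linarith)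
  have st : 0 < Real.sin (τ / 2) := Real.sin_pos_of_pos_of_lt_pi (by linarith) (by linarith)
  obtain ⟨μ, hμ⟩ : ∃ μ : ℝ, μ = Real.sin (τ / 2) * Real.sin (κ * τ) / 2 := ⟨_, rfl⟩
  have hμ0 : 0 < μ := by rw [hμ]; positivity
  obtain ⟨Tm, hTm⟩ : ∃ Tm : ℝ, Tm = τ + 2 / μ := ⟨_, rfl⟩
  have hTm0 : 0 < Tm := by rw [hTm]; positivity
  obtain ⟨f0, hf0⟩ : ∃ f0 : ℝ, f0 = (1 / 2) ^ (2 * p + 1) * Real.sin (κ * τ) := ⟨_, rfl⟩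
  have hf00 : 0 < f0 := by rw [hf0]; positivity
  obtain ⟨ε, hε⟩ : ∃ ε : ℝ, ε = min (b1 / 2) (min μ (min (f0 / 2 / Tm) 1)) := ⟨_, rfl⟩
  have hε0 : 0 < ε := by
    rw [hε]
    exact lt_min (by linarith) (lt_min hμ0 (lt_min (by positivity) one_pos))
  have hε1 : ε ≤ b1 / 2 := by rw [hε]; exact min_le_left _ _
  have hεμ : ε ≤ μ := by rw [hε]; exact (min_le_right _ _).trans (min_le_left _ _)
  have hεf : ε * Tm ≤ f0 / 2 := by
    have : ε ≤ f0 / 2 / Tm := by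
      rw [hε]
      exact (min_le_right _ _).trans ((min_le_right _ _).trans (min_le_left _ _))
    rwa [le_div_iff₀ hTm0] at this
  have hε2 : ε ≤ 1 := by
    rw [hε]
    exact (min_le_right _ _).trans ((min_le_right _ _).trans (min_le_right _ _))
  obtain ⟨c, hc⟩ : ∃ c : ℝ, c = min (min (f0 / 4) 1) (Real.cos (2 * b2)) := ⟨_, rfl⟩
  have hc0 : 0 < c := by rw [hc]; exact lt_min (lt_min (by linarith) one_pos) hb2c
  have hcf : c ≤ f0 / 4 := by rw [hc]; exact (min_le_left _ _).trans (min_le_left _ _)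
  have hc1 : c ≤ 1 := by rw [hc]; exact (min_le_left _ _).trans (min_le_right _ _)
  have hcb : c ≤ Real.cos (2 * b2) := by rw [hc]; exact min_le_right _ _
  refine ⟨c, hc0, ε, hε0, ?_⟩
  intro H b hH hb1b hbb2 x y a hS hx0 hy0 ha0
  have key : ∀ t, 0 ≤ t → (∀ s ∈ Icc 0 t, y s ≤ 0 ∧ κ * min s τ ≤ a s ∧ a s ≤ Real.pi / 2 ∧
      x s ≤ Real.pi / 2 ∧ c ≤ Real.cos (x s)) → Facts p b c H κ τ Tm x y a t := by
    intro t ht hg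
    exact inner hp hb1 hb1b hbb2 hb2 hM hτ0 hτ1 hτM hκ hμ hμ0 hTm hf0 hf00 hε1 hεμ hεf hε2 hc0
      hcf hcb hH hS hx0 hy0 ha0 ht (fun s hs => (hg s hs).1) (fun s hs => (hg s hs).2.1)
      (fun s hs => (hg s hs).2.2.1) (fun s hs => (hg s hs).2.2.2.1)
      (fun s hs => (hg s hs).2.2.2.2)
  have cx := hS.contx
  have cy := hS.conty
  have ca := hS.conta
  obtain ⟨T, hT0, hg, hmax⟩ := continuation (P := fun s => y s ≤ 0 ∧ κ * min s τ ≤ a s ∧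
      a s ≤ Real.pi / 2 ∧ x s ≤ Real.pi / 2 ∧ c ≤ Real.cos (x s)) (Tm := Tm)
    (by
      refine IsClosed.and (isClosed_le cy continuous_const) ?_
      refine IsClosed.and (isClosed_le (by fun_prop) ca) ?_
      refine IsClosed.and (isClosed_le ca continuous_const) ?_
      refine IsClosed.and (isClosed_le cx continuous_const) ?_
      exact isClosed_le continuous_const (by fun_prop))
    (by
      rw [hx0, hy0, ha0, min_eq_left hτ0.le, Real.cos_zero]
      exact ⟨by linarith, by linarith, by linarith, by linarith, hc1⟩)
    (fun t ht h => (key t ht h).le)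
  have F := key T hT0 hg
  have TT : T ∈ Icc 0 T := ⟨hT0, le_rfl⟩
  have sub : ∀ s ∈ Icc 0 T, 0 < Real.cos (x s) := fun s hs => hc0.trans_le (hg s hs).2.2.2.2
  have xlt : ∀ s ∈ Icc 0 T, x s < Real.pi / 2 := by
    intro s hs
    refine lt_of_le_of_ne (hg s hs).2.2.2.1 fun h => ?_
    have := sub s hs
    rw [h, Real.cos_pi_div_two] at this
    exact lt_irrefl _ this
  have hend : y T = 0 ∨ a T = Real.pi / 2 := by
    by_contra hcon
    push Not at hcon
    have yT : y T < 0 := lt_of_le_of_ne (hg T TT).1 hcon.1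
    have aT' : a T < Real.pi / 2 := lt_of_le_of_ne (hg T TT).2.2.1 hcon.2
    apply hmax
    have e1 : ∀ᶠ s in nhdsWithin T (Ici T), y s < 0 :=
      (cy.continuousWithinAt).eventually_lt continuousWithinAt_const yT
    have e2 : ∀ᶠ s in nhdsWithin T (Ici T), a s < Real.pi / 2 :=
      (ca.continuousWithinAt).eventually_lt continuousWithinAt_const aT'
    have e3 : ∀ᶠ s in nhdsWithin T (Ici T), x s < Real.pi / 2 :=
      (cx.continuousWithinAt).eventually_lt continuousWithinAt_const (xlt T TT)
    have e4 : ∀ᶠ s in nhdsWithin T (Ici T), c < Real.cos (x s) :=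
      continuousWithinAt_const.eventually_lt
        ((Real.continuous_cos.comp cx).continuousWithinAt) (F.cx T TT)
    have e5 : ∀ᶠ s in nhdsWithin T (Ici T), κ * min s τ ≤ a s := by
      rcases hT0.eq_or_lt with h | h
      · have hd := (hS.da 0)
        have hc' := (hg T TT).2.2.2.2
        have hcy' := F.cy T TT
        rw [← h] at hc' hcy'
        rw [aR_eq hc' hcy'] at hd
        have hs := (hasDerivAt_iff_tendsto_slope.mp hd).eventually
          (lt_mem_nhds (lt_of_lt_of_le (by linarith : κ < 2 * κ) F.da1))
        rw [← h]
        have hs2 : ∀ᶠ s in nhdsWithin (0:ℝ) (Ioi 0), κ * min s τ ≤ a s := by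
          have := hs.filter_mono (nhdsWithin_mono (0:ℝ)
            (fun s (hs : 0 < s) => (ne_of_gt hs : s ≠ 0) : Ioi (0:ℝ) ⊆ {0}ᶜ))
          filter_upwards [this, self_mem_nhdsWithin] with s hs1 hs0
          have hs0' : 0 < s := hs0
          rw [slope_def_field, ha0, sub_zero, sub_zero, lt_div_iff₀ hs0'] at hs1
          have : κ * min s τ ≤ κ * s := by
            gcongr; exact min_le_left _ _
          linarith
        rw [← Ioi_insert, nhdsWithin_insert]
        refine Filter.eventually_sup.mpr ⟨?_, hs2⟩
        rw [Filter.eventually_pure, ha0, min_eq_left hτ0.le]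
        linarith
      · have := F.a_gt T ⟨h, le_rfl⟩
        have hc : Continuous (fun s => κ * min s τ) := by fun_prop
        filter_upwards [hc.continuousWithinAt.eventually_lt (ca.continuousWithinAt) this] with s hs
        exact hs.le
    have := (e1.and (e5.and (e2.and (e3.and e4))))
    obtain ⟨u, hu, hsub⟩ := mem_nhdsGE_iff_exists_Icc_subset.mp this
    refine ⟨u, hu, fun s hs => ?_⟩
    obtain ⟨q1, q2, q3, q4, q5⟩ := hsub hs
    exact ⟨q1.le, q2, q3.le, q4.le, q5.le⟩
  have hTpos : 0 < T := by
    rcases hT0.eq_or_lt with h | h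
    · rw [← h, hy0, ha0] at hend
      rcases hend with h1 | h1 <;> linarith
    · exact h
  refine ⟨T, ⟨hTpos, hx0, hy0, ha0, fun s _ => hS.dx s, ?_, ?_, fun s hs => (hg s hs).1, F.y_b, ?_,
    fun s hs => (hg s hs).2.2.1, F.x_nn, xlt, fun s hs => (hg s hs).2.2.2.2, F.cy, F.da0⟩, hend⟩
  · intro s hs
    have := hS.dy s
    rwa [max_eq_left (hg s hs).2.2.2.2, ← div_eq_mul_inv] at this
  · intro s hs
    have := hS.da s
    rwa [aR_eq (hg s hs).2.2.2.2 (F.cy s hs)] at this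
  · intro s hs
    refine lt_of_le_of_lt ?_ (F.a_gt s hs)
    exact mul_nonneg hκ0.le (le_min hs.1.le hτ0.le)
/-! ### Part C: the two boundary cases for vanishing mean curvature -/

section arcfacts
variable {p : ℕ} {c H b T : ℝ} {x y a : ℝ → ℝ}

lemma Arc.ann (A : Arc p c H b x y a T) : ∀ s ∈ Icc 0 T, 0 ≤ a s := by
  intro s hs
  rcases hs.1.eq_or_lt with h | h
  · rw [← h, A.a0]
  · exact (A.ha s ⟨h, hs.2⟩).le

lemma Arc.cosa (A : Arc p c H b x y a T) : ∀ s ∈ Icc 0 T, 0 ≤ Real.cos (a s) := fun s hs =>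
  Real.cos_nonneg_of_mem_Icc ⟨by linarith [A.ann s hs, Real.pi_pos], A.ha' s hs⟩

lemma Arc.sina (A : Arc p c H b x y a T) : ∀ s ∈ Icc 0 T, 0 ≤ Real.sin (a s) := fun s hs =>
  Real.sin_nonneg_of_nonneg_of_le_pi (A.ann s hs) (by linarith [A.ha' s hs, Real.pi_pos])

lemma Arc.sina' (A : Arc p c H b x y a T) : ∀ s ∈ Ioc 0 T, 0 < Real.sin (a s) := fun s hs =>
  Real.sin_pos_of_pos_of_lt_pi (A.ha s hs)
    (by linarith [A.ha' s ⟨hs.1.le, hs.2⟩, Real.pi_pos])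

lemma Arc.sinx (A : Arc p c H b x y a T) : ∀ s ∈ Icc 0 T, 0 ≤ Real.sin (x s) := fun s hs =>
  Real.sin_nonneg_of_nonneg_of_le_pi (A.hx s hs) (by linarith [A.hx' s hs, Real.pi_pos])

lemma Arc.cosx (A : Arc p c H b x y a T) : ∀ s ∈ Icc 0 T, 0 < Real.cos (x s) := fun s hs =>
  Real.cos_pos_of_mem_Ioo ⟨by linarith [A.hx s hs, Real.pi_pos], A.hx' s hs⟩

lemma Arc.tany (A : Arc p c H b x y a T) (hb : b < Real.pi / 4) :
    ∀ s ∈ Icc 0 T, -(2 * y s) ≤ -(Real.sin (2 * y s) / Real.cos (2 * y s)) := by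
  intro s hs
  have := Real.le_tan (x := -(2 * y s)) (by linarith [A.hy s hs]) (by linarith [A.hyb s hs])
  rw [Real.tan_eq_sin_div_cos, Real.sin_neg, Real.cos_neg, neg_div] at this
  exact this

lemma Arc.tany' (A : Arc p c H b x y a T) (hb : b < Real.pi / 4) :
    ∀ s ∈ Icc 0 T, -(Real.sin (2 * y s) / Real.cos (2 * y s)) ≤ Real.tan (2 * b) := by
  intro s hs
  have h1 := A.hy s hs
  have h2 := A.hyb s hs
  have := Real.pi_pos
  have := Real.strictMonoOn_tan.monotoneOn (a := -(2 * y s)) (b := 2 * b)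
    ⟨by linarith, by linarith⟩ ⟨by linarith, by linarith⟩ (by linarith)
  rw [Real.tan_eq_sin_div_cos, Real.sin_neg, Real.cos_neg, neg_div] at this
  exact this

lemma Arc.cosy (A : Arc p c H b x y a T) (hb : b < Real.pi / 4) :
    ∀ s ∈ Icc 0 T, 0 < Real.cos (2 * y s) := fun s hs =>
  Real.cos_pos_of_mem_Ioo ⟨by linarith [A.hyb s hs], by linarith [A.hy s hs, Real.pi_pos]⟩

lemma sub_Icc {s t : ℝ} {T : ℝ} (hs : 0 ≤ s) (ht : t ≤ T) : ∀ u ∈ Icc s t, u ∈ Icc 0 T :=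
  fun _ hu => ⟨hs.trans hu.1, hu.2.trans ht⟩

lemma Arc.amono (A : Arc p c H b x y a T) {s t : ℝ} (hs : 0 ≤ s) (hst : s ≤ t) (ht : t ≤ T) :
    a s ≤ a t :=
  mono_hd hst (fun u hu => A.da u (sub_Icc hs ht u hu)) (fun u hu => (A.hda u (sub_Icc hs ht u hu)).le)

lemma Arc.xmono (A : Arc p c H b x y a T) {s t : ℝ} (hs : 0 ≤ s) (hst : s ≤ t) (ht : t ≤ T) :
    x s ≤ x t :=
  mono_hd hst (fun u hu => A.dx u (sub_Icc hs ht u hu)) (fun u hu => A.cosa u (sub_Icc hs ht u hu))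

lemma Arc.ymono (A : Arc p c H b x y a T) {s t : ℝ} (hs : 0 ≤ s) (hst : s ≤ t) (ht : t ≤ T) :
    y s ≤ y t :=
  mono_hd hst (fun u hu => A.dy u (sub_Icc hs ht u hu))
    (fun u hu => div_nonneg (A.sina u (sub_Icc hs ht u hu)) (A.cosx u (sub_Icc hs ht u hu)).le)

lemma Arc.ysmono (A : Arc p c H b x y a T) {s t : ℝ} (hs : 0 ≤ s) (hst : s < t) (ht : t ≤ T) :
    y s < y t :=
  strict_hd hst (fun u hu => A.dy u (sub_Icc hs ht u hu))
    (fun u hu => div_pos (A.sina' u ⟨hs.trans_lt hu.1, hu.2.le.trans ht⟩)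
      (A.cosx u (sub_Icc hs ht u ⟨hu.1.le, hu.2.le⟩)))

lemma Arc.cx (A : Arc p c H b x y a T) : ContinuousOn x (Icc 0 T) := fun s hs =>
  (A.dx s hs).continuousAt.continuousWithinAt
lemma Arc.cy (A : Arc p c H b x y a T) : ContinuousOn y (Icc 0 T) := fun s hs =>
  (A.dy s hs).continuousAt.continuousWithinAt
lemma Arc.ca (A : Arc p c H b x y a T) : ContinuousOn a (Icc 0 T) := fun s hs =>
  (A.da s hs).continuousAt.continuousWithinAt

end arcfacts

set_option maxHeartbeats 1000000 in
lemma claim1 {p : ℕ} (hp : 1 ≤ p) {c b T : ℝ} {x y a : ℝ → ℝ} (A : Arc p c 0 b x y a T)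
    (hb0 : 0 < b) (hb : b < Real.pi / 4)
    (hsmall : 2 * p * Real.tan (2 * b) * (4 / 3) < (1 / 2) ^ (2 * p + 1) * (3 / 5)) :
    a T ≠ Real.pi / 2 := by
  intro haT
  have pi4 := Real.pi_lt_four
  have pi3 := Real.pi_gt_three
  have hp1 : (1 : ℝ) ≤ p := by exact_mod_cast hp
  have TT : T ∈ Icc 0 T := ⟨A.pos.le, le_rfl⟩
  -- the time with slope 3/4
  obtain ⟨t0, ht0, hat0⟩ : ∃ t ∈ Icc 0 T, Real.cos (a t) = 3 / 4 := by
    have := intermediate_value_Icc' A.pos.le (f := fun s => Real.cos (a s))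
      (Real.continuous_cos.comp_continuousOn A.ca)
    have h : (3 / 4 : ℝ) ∈ Icc (Real.cos (a T)) (Real.cos (a 0)) := by
      rw [haT, A.a0, Real.cos_pi_div_two, Real.cos_zero]; norm_num
    obtain ⟨t, ht, h⟩ := this h
    exact ⟨t, ht, h⟩
  have ht0T : t0 < T := by
    refine lt_of_le_of_ne ht0.2 fun h => ?_
    rw [h, haT, Real.cos_pi_div_two] at hat0
    norm_num at hat0
  have sub0 : ∀ u ∈ Icc 0 t0, u ∈ Icc 0 T := sub_Icc le_rfl ht0.2
  have hcos : ∀ s ∈ Icc 0 t0, 3 / 4 ≤ Real.cos (a s) := by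
    intro s hs
    rw [← hat0]
    exact Real.cos_le_cos_of_nonneg_of_le_pi (A.ann s (sub0 s hs)) (by linarith [A.ha' t0 ht0])
      (A.amono hs.1 hs.2 ht0.2)
  have hsin0 : 3 / 5 ≤ Real.sin (a t0) := by
    have h1 := Real.sin_sq_add_cos_sq (a t0)
    rw [hat0] at h1
    have h2 := A.sina t0 ht0
    nlinarith
  have dF : ∀ s ∈ Icc 0 T, HasDerivAt (fun s => Real.cos (x s) ^ (2 * p + 1) * Real.sin (a s))
      (Real.cos (x s) ^ (2 * p) * Real.cos (a s) *
        (2 * p * (-(Real.sin (2 * y s) / Real.cos (2 * y s))) * Real.cos (a s))) s := by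
    intro s hs
    refine (flux1 (A.dx s hs) (A.da s hs) (A.cosx s hs).ne').congr_deriv ?_
    ring
  have hx1 : 1 < x t0 := by
    by_contra hcon
    push Not at hcon
    have h1 := upper_hd (k := 2 * p * Real.tan (2 * b)) ht0.1 (fun u hu => dF u (sub0 u hu))
      (fun u hu => by
        have hu' := sub0 u hu
        have q0 := A.cosa u hu'
        have q1 := Real.cos_le_one (a u)
        have q2 : Real.cos (x u) ^ (2 * p) ≤ 1 :=
          pow_le_one₀ (A.cosx u hu').le (Real.cos_le_one _)
        have q2' : 0 ≤ Real.cos (x u) ^ (2 * p) := pow_nonneg (A.cosx u hu').le _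
        have q3 := A.tany' hb u hu'
        have q3' : 0 ≤ -(Real.sin (2 * y u) / Real.cos (2 * y u)) := by
          linarith [A.tany hb u hu', A.hy u hu']
        have r1 : Real.cos (x u) ^ (2 * p) * Real.cos (a u) ≤ 1 := mul_le_one₀ q2 q0 q1
        have r2 : 2 * p * (-(Real.sin (2 * y u) / Real.cos (2 * y u))) * Real.cos (a u)
            ≤ 2 * p * Real.tan (2 * b) * 1 := by
          gcongr
          exact mul_nonneg (by positivity) (q3'.trans q3)
        have r3 : 0 ≤ 2 * p * (-(Real.sin (2 * y u) / Real.cos (2 * y u))) * Real.cos (a u) :=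
          mul_nonneg (mul_nonneg (by positivity) q3') q0
        have r4 : 0 ≤ Real.cos (x u) ^ (2 * p) * Real.cos (a u) := mul_nonneg q2' q0
        nlinarith)
    simp only [A.x0, A.a0, Real.sin_zero, mul_zero, zero_add, sub_zero] at h1
    have h2 := lower_hd (k := 3 / 4) ht0.1 (fun u hu => A.dx u (sub0 u hu)) hcos
    rw [A.x0] at h2
    have h3 : t0 ≤ 4 / 3 := by linarith
    have h4 : 0 ≤ 2 * p * Real.tan (2 * b) := mul_nonneg (by positivity)
      (Real.tan_nonneg_of_nonneg_of_le_pi_div_two (by linarith) (by linarith))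
    have h5 : (1 / 2) ^ (2 * p + 1) * (3 / 5) ≤ Real.cos (x t0) ^ (2 * p + 1) * Real.sin (a t0) := by
      have := half_le_cos (A.hx t0 ht0) hcon
      gcongr
    have h6 := mul_le_mul_of_nonneg_left h3 h4
    linarith
  have hs0 : 2 / 3 ≤ Real.sin (x t0) ^ 2 := by
    have h1 : Real.cos (x t0) ≤ 5 / 9 :=
      (Real.cos_le_cos_of_nonneg_of_le_pi zero_le_one (by linarith [A.hx' t0 ht0]) hx1.le).trans
        Real.cos_one_le
    have h2 := A.cosx t0 ht0
    have h3 := Real.sin_sq_add_cos_sq (x t0)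
    nlinarith
  obtain ⟨t1, ht1, hst1⟩ : ∃ t ∈ Icc 0 t0, Real.sin (x t) ^ 2 = 2 / 3 := by
    have := intermediate_value_Icc ht0.1 (f := fun s => Real.sin (x s) ^ 2)
      ((Real.continuous_sin.comp_continuousOn (A.cx.mono sub0)).pow 2)
    have h : (2 / 3 : ℝ) ∈ Icc (Real.sin (x 0) ^ 2) (Real.sin (x t0) ^ 2) := by
      rw [A.x0, Real.sin_zero]; exact ⟨by norm_num, hs0⟩
    obtain ⟨t, ht, h⟩ := this h
    exact ⟨t, ht, h⟩
  have ht1T : t1 < T := ht1.2.trans_lt ht0T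
  have ht1' : t1 ∈ Icc 0 T := ⟨ht1.1, ht1T.le⟩
  have sub1 : ∀ u ∈ Icc 0 t1, u ∈ Icc 0 T := sub_Icc le_rfl ht1T.le
  have yt1 : y t1 < 0 := (A.ysmono ht1.1 ht1T le_rfl).trans_le (A.hy T TT)
  have dW : ∀ s ∈ Icc 0 T, HasDerivAt (fun s =>
      -(Real.cos (x s) ^ (2 * p + 1) * Real.sin (a s)) * (1 - 3 / 2 * Real.sin (x s) ^ 2)
        + -3 * y s * (Real.cos (x s) ^ (2 * p + 3) * Real.sin (x s)))
      (-(Real.cos (x s) ^ (2 * p) * Real.cos (a s) *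
        (2 * p * (-(Real.sin (2 * y s) / Real.cos (2 * y s))) * Real.cos (a s)))
          * (1 - 3 / 2 * Real.sin (x s) ^ 2)
        + 3 * Real.cos (x s) ^ (2 * p + 2) * Real.sin (a s) * Real.sin (x s) * (Real.cos (a s) - 1)
        + 3 * (-y s) * Real.cos (a s) * Real.cos (x s) ^ (2 * p + 2) *
          (Real.cos (x s) ^ 2 - (2 * p + 3) * Real.sin (x s) ^ 2)) s := by
    intro s hs
    have d1 := ((A.dx s hs).sin.pow 2).const_mul (3 / 2)
    have d2 := ((dF s hs).neg).mul (d1.const_sub 1)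
    have d3 := (((A.dx s hs).cos).pow (2 * p + 3)).mul (A.dx s hs).sin
    have d4 := ((A.dy s hs).const_mul (-3)).mul d3
    refine (d2.add d4).congr_deriv ?_
    have hcx := (A.cosx s hs).ne'
    simp only [Pi.pow_apply, Pi.mul_apply, Pi.neg_apply,
      show 2 * p + 3 - 1 = 2 * p + 2 by omega]
    push_cast
    field_simp
    ring
  have h1 := anti_hd ht1.1 (fun u hu => dW u (sub1 u hu)) (fun u hu => by
    have hu' := sub1 u hu
    have q0 : 0 < Real.cos (a u) := by linarith [hcos u ⟨hu.1, hu.2.trans ht1.2⟩]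
    have q0' := hcos u ⟨hu.1, hu.2.trans ht1.2⟩
    have q1 := Real.cos_le_one (a u)
    have q2 := A.cosx u hu'
    have q3 := A.tany hb u hu'
    have q4 := A.hy u hu'
    have q5 := A.sina u hu'
    have q6 := A.sinx u hu'
    have q7 : Real.sin (x u) ^ 2 ≤ 2 / 3 := by
      rw [← hst1]
      have : Real.sin (x u) ≤ Real.sin (x t1) :=
        Real.sin_le_sin_of_le_of_le_pi_div_two (by linarith [A.hx u hu']) (A.hx' t1 ht1').le
          (A.xmono hu.1 hu.2 ht1T.le)
      gcongr
    have q8 := Real.sin_sq_add_cos_sq (x u)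
    set S := Real.sin (x u) ^ 2 with hS
    set w := -(Real.sin (2 * y u) / Real.cos (2 * y u)) with hw
    have r1 : 3 * Real.cos (x u) ^ (2 * p + 2) * Real.sin (a u) * Real.sin (x u) *
        (Real.cos (a u) - 1) ≤ 0 :=
      mul_nonpos_of_nonneg_of_nonpos (by positivity) (by linarith)
    have hC2 : Real.cos (x u) ^ 2 = 1 - S := by linarith
    have S0 : 0 ≤ S := by rw [hS]; positivity
    have r2 : 2 * p * w * Real.cos (a u) ≥ 2 * p * (2 * (-y u)) * (3 / 4) := by
      have : 0 ≤ w := by linarith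
      have : 0 ≤ -y u := by linarith
      gcongr
      linarith
    have br : -(2 * p * (2 * (-y u)) * (3 / 4)) * (1 - 3 / 2 * S)
        + 3 * (-y u) * (1 - S) * ((1 - S) - (2 * p + 3) * S) ≤ 0 := by
      have e : -(2 * p * (2 * (-y u)) * (3 / 4)) * (1 - 3 / 2 * S)
        + 3 * (-y u) * (1 - S) * ((1 - S) - (2 * p + 3) * S)
        = (-y u) * ((3 - 3 * p) - S * (3 / 2 * p + 15) + 3 * (2 * p + 4) * S ^ 2) := by ring
      rw [e]
      refine mul_nonpos_of_nonneg_of_nonpos (by linarith) ?_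
      have : S ^ 2 ≤ 2 / 3 * S := by nlinarith
      nlinarith
    have r3 : -(2 * p * w * Real.cos (a u)) * (1 - 3 / 2 * S)
        ≤ -(2 * p * (2 * (-y u)) * (3 / 4)) * (1 - 3 / 2 * S) :=
      mul_le_mul_of_nonneg_right (by linarith) (by linarith)
    have r4 : Real.cos (x u) ^ (2 * p) * Real.cos (a u) * (
        -(2 * p * w * Real.cos (a u)) * (1 - 3 / 2 * S)
        + 3 * (-y u) * (1 - S) * ((1 - S) - (2 * p + 3) * S)) ≤ 0 :=
      mul_nonpos_of_nonneg_of_nonpos (by positivity) (by linarith)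
    rw [pow_add _ (2 * p) 2, hC2] at r1 ⊢
    linarith)
  simp only [A.x0, A.a0, Real.sin_zero, hst1] at h1
  have h2 : 0 < -3 * y t1 * (Real.cos (x t1) ^ (2 * p + 3) * Real.sin (x t1)) := by
    have := A.sinx t1 ht1'
    have h3 : 0 < Real.sin (x t1) := by
      refine lt_of_le_of_ne this fun h => ?_
      rw [← h] at hst1; norm_num at hst1
    have := A.cosx t1 ht1'
    have : 0 < -y t1 := by linarith
    have : 0 < 3 * (-y t1) * (Real.cos (x t1) ^ (2 * p + 3) * Real.sin (x t1)) := by positivity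
    linarith
  norm_num at h1
  linarith
set_option maxHeartbeats 1000000 in
lemma claim2 {p : ℕ} (hp : 1 ≤ p) {c b T δ K : ℝ} {x y a : ℝ → ℝ} (A : Arc p c 0 b x y a T)
    (hb0 : 0 < b) (hb : b < Real.pi / 4) (hδ : Real.cos (2 * b) = δ) (hδ4 : δ ≤ 1 / 4)
    (hK : K = (2 * p + 1) * (1 / 2) ^ p * (Real.pi / 6))
    (hδK : δ < 3 / 8 * K) (hlog : 1 < K * (27 / 256) * (Real.log (1 / 2) - Real.log δ)) :
    y T ≠ 0 := by
  intro hyT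
  have pi3 := Real.pi_gt_three
  have hp1 : (1 : ℝ) ≤ p := by exact_mod_cast hp
  have TT : T ∈ Icc 0 T := ⟨A.pos.le, le_rfl⟩
  have Z0 : (0 : ℝ) ∈ Icc 0 T := ⟨le_rfl, A.pos.le⟩
  have hδ0 : 0 < δ := by
    rw [← hδ]; exact Real.cos_pos_of_mem_Ioo ⟨by linarith, by linarith⟩
  have hK0 : 0 < K := by rw [hK]; positivity
  have hb6 : Real.pi / 6 ≤ b := by
    by_contra hcon
    push Not at hcon
    have := Real.cos_lt_cos_of_nonneg_of_le_pi (x := 2 * b) (y := Real.pi / 3) (by linarith)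
      (by linarith) (by linarith)
    rw [Real.cos_pi_div_three, hδ] at this
    linarith
  obtain ⟨t1, ht1, hyt1⟩ : ∃ t ∈ Icc 0 T, y t = -(Real.pi / 6) := by
    have h : -(Real.pi / 6) ∈ Icc (y 0) (y T) := by
      rw [A.y0, hyT]; constructor <;> linarith
    obtain ⟨t, ht, h⟩ := intermediate_value_Icc A.pos.le A.cy h
    exact ⟨t, ht, h⟩
  have sub1 : ∀ u ∈ Icc 0 t1, u ∈ Icc 0 T := sub_Icc le_rfl ht1.2
  have sub2 : ∀ u ∈ Icc t1 T, u ∈ Icc 0 T := sub_Icc ht1.1 le_rfl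
  have dG : ∀ s ∈ Icc 0 T, HasDerivAt (fun s => Real.cos (2 * y s) ^ p * Real.cos (a s))
      (-(2 * (p : ℝ) + 1) * (Real.sin (a s) / Real.cos (x s)) *
        (Real.cos (2 * y s) ^ p * Real.sin (x s) * Real.sin (a s))) s := by
    intro s hs
    refine (flux2 hp (A.dy s hs) (A.da s hs) (A.cosx s hs).ne' (A.cosy hb s hs).ne').congr_deriv ?_
    have := (A.cosx s hs).ne'
    field_simp
    ring
  have hsc : ∀ s ∈ Icc 0 T, 0 ≤ (2 * (p : ℝ) + 1) * (Real.sin (a s) / Real.cos (x s)) :=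
    fun s hs => mul_nonneg (by positivity) (div_nonneg (A.sina s hs) (A.cosx s hs).le)
  have Gmono : ∀ s t, 0 ≤ s → s ≤ t → t ≤ T → Real.cos (2 * y t) ^ p * Real.cos (a t)
      ≤ Real.cos (2 * y s) ^ p * Real.cos (a s) := by
    intro s t hs hst ht
    refine anti_hd hst (fun u hu => dG u (sub_Icc hs ht u hu)) (fun u hu => ?_)
    have hu' := sub_Icc hs ht u hu
    have q1 := hsc u hu'
    have q2 : 0 ≤ Real.cos (2 * y u) ^ p * Real.sin (x u) * Real.sin (a u) :=
      mul_nonneg (mul_nonneg (pow_nonneg (A.cosy hb u hu').le _) (A.sinx u hu')) (A.sina u hu')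
    have := mul_nonneg q1 q2
    linarith
  have hG0 : Real.cos (2 * y 0) ^ p * Real.cos (a 0) = δ ^ p := by
    rw [A.y0, A.a0, Real.cos_zero, mul_one, mul_neg, Real.cos_neg, hδ]
  have G0pos : 0 < δ ^ p := pow_pos hδ0 _
  have G0le : δ ^ p ≤ δ := by
    have := pow_le_pow_of_le_one hδ0.le (by linarith) hp
    simpa using this
  set X := Real.sin (x t1) with hX
  have X0 : 0 ≤ X := A.sinx t1 ht1
  have snle : ∀ s ∈ Icc 0 t1, Real.sin (x s) ≤ X := fun s hs =>
    Real.sin_le_sin_of_le_of_le_pi_div_two (by linarith [A.hx s (sub1 s hs)]) (A.hx' t1 ht1).le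
      (A.xmono hs.1 hs.2 ht1.2)
  have snge : ∀ s ∈ Icc t1 T, X ≤ Real.sin (x s) := fun s hs =>
    Real.sin_le_sin_of_le_of_le_pi_div_two (by linarith [A.hx t1 ht1]) (A.hx' s (sub2 s hs)).le
      (A.xmono ht1.1 hs.1 hs.2)
  have cyle : ∀ s ∈ Icc 0 t1, Real.cos (2 * y s) ≤ 1 / 2 := by
    intro s hs
    rw [← Real.cos_pi_div_three, ← Real.cos_neg (2 * y s)]
    have h1 := A.ymono hs.1 hs.2 ht1.2
    have h2 := A.hyb s (sub1 s hs)
    exact Real.cos_le_cos_of_nonneg_of_le_pi (by linarith) (by linarith) (by linarith)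
  have cyge : ∀ s ∈ Icc t1 T, 1 / 2 ≤ Real.cos (2 * y s) := by
    intro s hs
    rw [← Real.cos_pi_div_three, ← Real.cos_neg (2 * y s)]
    have h1 := A.ymono ht1.1 hs.1 hs.2
    have h2 := A.hy s (sub2 s hs)
    exact Real.cos_le_cos_of_nonneg_of_le_pi (by linarith) (by linarith) (by linarith)
  have snage : ∀ s ∈ Icc t1 T, 3 / 4 ≤ Real.sin (a s) := by
    intro s hs
    have h1 := Gmono 0 s le_rfl (ht1.1.trans hs.1) hs.2
    rw [hG0] at h1
    have h2 : (1 / 2 : ℝ) ^ p ≤ Real.cos (2 * y s) ^ p :=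
      pow_le_pow_left₀ (by norm_num) (cyge s hs) p
    have h3 : (1 / 2 : ℝ) ^ p * Real.cos (a s) ≤ δ ^ p :=
      (mul_le_mul_of_nonneg_right h2 (A.cosa s (sub2 s hs))).trans h1
    have h4 : δ ^ p = (1 / 2) ^ p * (2 * δ) ^ p := by
      rw [← mul_pow]; congr 1; ring
    rw [h4] at h3
    have h5 : Real.cos (a s) ≤ (2 * δ) ^ p := le_of_mul_le_mul_left h3 (by positivity)
    have h6 : (2 * δ) ^ p ≤ 2 * δ := by
      have := pow_le_pow_of_le_one (a := 2 * δ) (by linarith) (by linarith) hp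
      simpa using this
    have h7 := A.cosa s (sub2 s hs)
    have h8 := A.sina s (sub2 s hs)
    have h9 := Real.sin_sq_add_cos_sq (a s)
    have h10 : Real.cos (a s) ≤ 1 / 2 := by linarith
    nlinarith
  have E1 : 3 / 4 * K * X ≤ Real.cos (2 * y t1) ^ p * Real.cos (a t1) := by
    have := anti_hd ht1.2 (fun u hu => (dG u (sub2 u hu)).add
      ((A.dy u (sub2 u hu)).const_mul ((2 * p + 1) * (X * (3 / 4) * (1 / 2) ^ p))))
      (fun u hu => by
        have hu' := sub2 u hu
        have q1 := hsc u hu'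
        have q2 : (1 / 2 : ℝ) ^ p * X * (3 / 4)
            ≤ Real.cos (2 * y u) ^ p * Real.sin (x u) * Real.sin (a u) := by
          have := cyge u hu
          have := snge u hu
          have := snage u hu
          have := A.sinx u hu'
          gcongr
        nlinarith [mul_le_mul_of_nonneg_left q2 q1])
    simp only [Pi.add_apply] at this
    have h2 : 0 ≤ Real.cos (2 * y T) ^ p * Real.cos (a T) :=
      mul_nonneg (pow_nonneg (A.cosy hb T TT).le _) (A.cosa T TT)
    rw [hK]
    generalize Real.cos (2 * y T) ^ p * Real.cos (a T) = gT at *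
    generalize Real.cos (2 * y t1) ^ p * Real.cos (a t1) = g1 at *
    generalize (1 / 2 : ℝ) ^ p = q at *
    rw [hyT, hyt1] at this
    linarith
  have E2 : δ ^ p - K / 2 * X ≤ Real.cos (2 * y t1) ^ p * Real.cos (a t1) := by
    have := mono_hd ht1.1 (fun u hu => (dG u (sub1 u hu)).add
      ((A.dy u (sub1 u hu)).const_mul ((2 * p + 1) * (X * (1 / 2) ^ p))))
      (fun u hu => by
        have hu' := sub1 u hu
        have q1 := hsc u hu'
        have q2 : Real.cos (2 * y u) ^ p * Real.sin (x u) * Real.sin (a u)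
            ≤ (1 / 2 : ℝ) ^ p * X * 1 := by
          have := cyle u hu
          have := snle u hu
          have := Real.sin_le_one (a u)
          have := A.sinx u hu'
          have := A.sina u hu'
          have := A.cosy hb u hu'
          gcongr
        nlinarith [mul_le_mul_of_nonneg_left q2 q1])
    simp only [Pi.add_apply] at this
    rw [hG0] at this
    rw [hK]
    have h3 : 0 ≤ (2 * (p : ℝ) + 1) * (X * (1 / 2) ^ p) := by positivity
    have h4 : b - Real.pi / 6 ≤ Real.pi / 12 := by linarith
    have h5 := mul_le_mul_of_nonneg_left h4 h3
    generalize Real.cos (2 * y t1) ^ p * Real.cos (a t1) = g1 at *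
    generalize (1 / 2 : ℝ) ^ p = q at *
    rw [hyt1, A.y0] at this
    linarith
  have hle := Gmono 0 t1 le_rfl ht1.1 ht1.2
  rw [hG0] at hle
  set G1 := Real.cos (2 * y t1) ^ p * Real.cos (a t1) with hG1
  have half : δ ^ p / 2 ≤ G1 := by
    by_contra hcon
    push Not at hcon
    linarith
  have Xlt : X < 1 / 2 := by
    by_contra hcon
    push Not at hcon
    have := mul_le_mul_of_nonneg_left hcon (by positivity : 0 ≤ 3 / 4 * K)
    linarith
  have E3 := mono_hd ht1.1 (fun u hu => ((A.dx u (sub1 u hu)).sin).sub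
      (((((A.dy u (sub1 u hu)).const_mul 2).cos).log (A.cosy hb u (sub1 u hu)).ne').const_mul
        (9 / 64 * δ ^ p)))
    (fun u hu => by
      have hu' := sub1 u hu
      have w0 := A.cosy hb u hu'
      have w1 := cyle u hu
      have c0 := A.cosx u hu'
      have c1 : 3 / 4 ≤ Real.cos (x u) := by
        have h1 := Real.sin_sq_add_cos_sq (x u)
        have h2 := A.sinx u hu'
        have h3 := snle u hu
        nlinarith
      have s0 := A.sina u hu'
      have s1 := Real.sin_le_one (a u)
      have y0 : 0 ≤ -Real.sin (2 * y u) := by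
        have := Real.sin_nonpos_of_nonpos_of_neg_pi_le (x := 2 * y u) (by linarith [A.hy u hu'])
          (by linarith [A.hyb u hu'])
        linarith
      have y1 : -Real.sin (2 * y u) ≤ 1 := by linarith [Real.neg_one_le_sin (2 * y u)]
      have g1 : δ ^ p / 2 ≤ Real.cos (2 * y u) * Real.cos (a u) := by
        have h1 := Gmono u t1 hu.1 hu.2 ht1.2
        have h2 : Real.cos (2 * y u) ^ p ≤ Real.cos (2 * y u) := by
          have := pow_le_pow_of_le_one (a := Real.cos (2 * y u)) w0.le (by linarith) hp
          simpa using this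
        have := mul_le_mul_of_nonneg_right h2 (A.cosa u hu')
        linarith
      have k1 : 3 / 8 * δ ^ p / Real.cos (2 * y u) ≤ Real.cos (x u) * Real.cos (a u) := by
        rw [div_le_iff₀ w0]
        have := mul_le_mul c1 g1 (by positivity) c0.le
        linarith
      have k2 : Real.sin (a u) / Real.cos (x u) ≤ 4 / 3 := by
        rw [div_le_iff₀ c0]; linarith
      have k2' : 0 ≤ Real.sin (a u) / Real.cos (x u) := div_nonneg s0 c0.le
      have k3 : 9 / 64 * δ ^ p * (-Real.sin (2 * y u) * (2 * (Real.sin (a u) / Real.cos (x u)))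
          / Real.cos (2 * y u)) ≤ 3 / 8 * δ ^ p / Real.cos (2 * y u) := by
        rw [← mul_div_assoc]
        refine div_le_div_of_nonneg_right ?_ w0.le
        have : -Real.sin (2 * y u) * (2 * (Real.sin (a u) / Real.cos (x u))) ≤ 1 * (2 * (4 / 3)) := by
          gcongr
        have := mul_le_mul_of_nonneg_left this (by positivity : 0 ≤ 9 / 64 * δ ^ p)
        linarith
      linarith)
  simp only [Pi.sub_apply, A.x0, A.y0, Real.sin_zero, hyt1] at E3
  rw [show (2 : ℝ) * -(Real.pi / 6) = -(Real.pi / 3) by ring, Real.cos_neg, Real.cos_pi_div_three,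
    mul_neg, Real.cos_neg, hδ, ← hX] at E3
  have E4 : 9 / 64 * δ ^ p * (Real.log (1 / 2) - Real.log δ) ≤ X := by linarith
  have E5 := mul_le_mul_of_nonneg_left E4 (by positivity : 0 ≤ 3 / 4 * K)
  have E6 := mul_lt_mul_of_pos_left hlog G0pos
  linarith
/-! ### Part D: shooting -/

def U1 (y a : ℝ → ℝ) : Prop := ∃ t > 0, 0 < y t ∧ ∀ s ∈ Icc 0 t, a s < Real.pi / 2
def U2 (y a : ℝ → ℝ) : Prop := ∃ t > 0, Real.pi / 2 < a t ∧ ∀ s ∈ Icc 0 t, y s < 0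

lemma U_disj {y a : ℝ → ℝ} (h1 : U1 y a) (h2 : U2 y a) : False := by
  obtain ⟨t, ht, hy, ha⟩ := h1
  obtain ⟨t', ht', ha', hy'⟩ := h2
  rcases le_total t t' with h | h
  · exact lt_asymm hy (hy' t ⟨ht.le, h⟩)
  · exact lt_asymm ha' (ha t' ⟨ht'.le, h⟩)

lemma persist1 {p : ℕ} {c H : ℝ} (hc : 0 < c) {x y a : ℝ → ℝ} (hS : Sol p c H x y a)
    (hU : U1 y a) : ∃ δ > 0, ∀ H' x' y' a', Sol p c H' x' y' a' → |H' - H| ≤ δ → x 0 = x' 0 →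
      |y 0 - y' 0| ≤ δ → a 0 = a' 0 → U1 y' a' := by
  obtain ⟨t, ht, hy, ha⟩ := hU
  obtain ⟨m, hm, hmax⟩ := isCompact_Icc.exists_isMaxOn (nonempty_Icc.mpr ht.le)
    (hS.conta.continuousOn (s := Icc 0 t))
  have h1 := ha m hm
  obtain ⟨δ, hδ, h⟩ := Sol.cont p hc H t (min (y t) (Real.pi / 2 - a m)) (lt_min hy (by linarith))
  refine ⟨δ, hδ, fun H' x' y' a' hS' hH hx0 hy0 ha0 => ?_⟩
  have h' := h x y a x' y' a' H' hS hS' hH hx0 hy0 ha0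
  refine ⟨t, ht, ?_, fun s hs => ?_⟩
  · have := (h' t ⟨ht.le, le_rfl⟩).2.1.trans_le (min_le_left _ _)
    have := (abs_lt.mp this).2
    linarith
  · have := (h' s hs).2.2.trans_le (min_le_right _ _)
    have := (abs_lt.mp this).1
    have := hmax hs
    simp only [mem_ofPred_eq] at this
    linarith

lemma persist2 {p : ℕ} {c H : ℝ} (hc : 0 < c) {x y a : ℝ → ℝ} (hS : Sol p c H x y a)
    (hU : U2 y a) : ∃ δ > 0, ∀ H' x' y' a', Sol p c H' x' y' a' → |H' - H| ≤ δ → x 0 = x' 0 →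
      |y 0 - y' 0| ≤ δ → a 0 = a' 0 → U2 y' a' := by
  obtain ⟨t, ht, ha, hy⟩ := hU
  obtain ⟨m, hm, hmax⟩ := isCompact_Icc.exists_isMaxOn (nonempty_Icc.mpr ht.le)
    (hS.conty.continuousOn (s := Icc 0 t))
  have h1 := hy m hm
  obtain ⟨δ, hδ, h⟩ := Sol.cont p hc H t (min (- y m) (a t - Real.pi / 2))
    (lt_min (by linarith) (by linarith))
  refine ⟨δ, hδ, fun H' x' y' a' hS' hH hx0 hy0 ha0 => ?_⟩
  have h' := h x y a x' y' a' H' hS hS' hH hx0 hy0 ha0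
  refine ⟨t, ht, ?_, fun s hs => ?_⟩
  · have := (h' t ⟨ht.le, le_rfl⟩).2.2.trans_le (min_le_right _ _)
    have := (abs_lt.mp this).2
    linarith
  · have := (h' s hs).2.1.trans_le (min_le_left _ _)
    have := (abs_lt.mp this).1
    have := hmax hs
    simp only [mem_ofPred_eq] at this
    linarith

lemma pos_right {f : ℝ → ℝ} {f' t : ℝ} (h : HasDerivAt f f' t) (hf : 0 < f') :
    ∀ᶠ s in nhdsWithin t (Ioi t), f t < f s := by
  have hs := (hasDerivAt_iff_tendsto_slope.mp h).eventually (lt_mem_nhds hf)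
  have := hs.filter_mono (nhdsWithin_mono t
            (fun s (hs : t < s) => (ne_of_gt hs : s ≠ t) : Ioi t ⊆ {t}ᶜ))
  filter_upwards [this, self_mem_nhdsWithin] with s hs1 hs0
  have hs0' : 0 < s - t := sub_pos.mpr hs0
  rw [slope_def_field, lt_div_iff₀ hs0'] at hs1
  linarith

/-- if `g < k` at `t` and `f' > 0` at `t`, there is `u > t` with `f u > f t` and `g < k` on `[t,u]` -/
lemma step_right {f g : ℝ → ℝ} {f' t k : ℝ} (h : HasDerivAt f f' t) (hf : 0 < f')
    (hg : Continuous g) (hk : g t < k) : ∃ u > t, f t < f u ∧ ∀ s ∈ Icc t u, g s < k := by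
  have e1 : ∀ᶠ s in nhdsWithin t (Ici t), g s < k :=
    (hg.continuousWithinAt).eventually_lt continuousWithinAt_const hk
  obtain ⟨u, hu, hsub⟩ := mem_nhdsGE_iff_exists_Icc_subset.mp e1
  have hu' : t < u := hu
  obtain ⟨v, hv1, hv2⟩ := ((pos_right h hf).and (Ioc_mem_nhdsGT hu')).exists
  exact ⟨v, hv2.1, hv1, fun s hs => hsub ⟨hs.1, hs.2.trans hv2.2⟩⟩

lemma arcU1 {p : ℕ} {c H b T : ℝ} {x y a : ℝ → ℝ} (hS : Sol p c H x y a)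
    (A : Arc p c H b x y a T) (h1 : y T = 0) (h2 : a T < Real.pi / 2) : U1 y a := by
  have TT : T ∈ Icc 0 T := ⟨A.pos.le, le_rfl⟩
  obtain ⟨u, hu, hy, ha⟩ := step_right (A.dy T TT)
    (div_pos (A.sina' T ⟨A.pos, le_rfl⟩) (A.cosx T TT)) hS.conta h2
  refine ⟨u, A.pos.trans hu, by linarith, fun s hs => ?_⟩
  rcases le_total s T with h | h
  · exact (A.amono hs.1 h le_rfl).trans_lt h2
  · exact ha s ⟨h, hs.2⟩

lemma arcU2 {p : ℕ} {c H b T : ℝ} {x y a : ℝ → ℝ} (hS : Sol p c H x y a)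
    (A : Arc p c H b x y a T) (h1 : y T < 0) (h2 : a T = Real.pi / 2) : U2 y a := by
  have TT : T ∈ Icc 0 T := ⟨A.pos.le, le_rfl⟩
  obtain ⟨u, hu, ha, hy⟩ := step_right (A.da T TT) (A.hda T TT) hS.conty h1
  refine ⟨u, A.pos.trans hu, by linarith, fun s hs => ?_⟩
  rcases le_total s T with h | h
  · exact (A.ymono hs.1 h le_rfl).trans_lt h1
  · exact hy s ⟨h, hs.2⟩

lemma constants {p : ℕ} (hp : 1 ≤ p) : ∃ b1 b2 δ K : ℝ, 0 < b1 ∧ b1 ≤ b2 ∧ b2 < Real.pi / 4 ∧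
    2 * p * Real.tan (2 * b1) * (4 / 3) < (1 / 2) ^ (2 * p + 1) * (3 / 5) ∧
    Real.cos (2 * b2) = δ ∧ δ ≤ 1 / 4 ∧ K = (2 * p + 1) * (1 / 2) ^ p * (Real.pi / 6) ∧
    δ < 3 / 8 * K ∧ 1 < K * (27 / 256) * (Real.log (1 / 2) - Real.log δ) := by
  obtain ⟨K, hK⟩ : ∃ K : ℝ, K = (2 * p + 1) * (1 / 2) ^ p * (Real.pi / 6) := ⟨_, rfl⟩
  have hK0 : 0 < K := by rw [hK]; have := Real.pi_pos; positivity
  have e1 : ∀ᶠ δ in nhdsWithin (0:ℝ) (Ioi 0), Real.log δ < Real.log (1 / 2) - 256 / 27 / K :=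
    Real.tendsto_log_nhdsGT_zero.eventually (Filter.eventually_lt_atBot _)
  have e2 : ∀ᶠ δ in nhdsWithin (0:ℝ) (Ioi 0), δ < min (1 / 4) (3 / 8 * K) :=
    mem_nhdsWithin_of_mem_nhds (Iio_mem_nhds (lt_min (by norm_num) (by positivity)))
  obtain ⟨δ, ⟨h1, h2⟩, h0⟩ := ((e1.and e2).and self_mem_nhdsWithin).exists
  have h0' : 0 < δ := h0
  have h2a := h2.trans_le (min_le_left _ _)
  have h2b := h2.trans_le (min_le_right _ _)
  have hcos : Real.cos (2 * (Real.arccos δ / 2)) = δ := by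
    rw [mul_div_cancel₀ _ (by norm_num : (2:ℝ) ≠ 0)]
    exact Real.cos_arccos (by linarith) (by linarith)
  have hb2 : Real.arccos δ / 2 < Real.pi / 4 := by
    have := Real.arccos_lt_pi_div_two.mpr h0'
    linarith
  have hb2' : 0 < Real.arccos δ / 2 := by
    have := Real.arccos_pos.mpr (by linarith : δ < 1)
    linarith
  have e3 : ∀ᶠ b in nhdsWithin (0:ℝ) (Ioi 0), b < Real.arccos δ / 2 :=
    mem_nhdsWithin_of_mem_nhds (Iio_mem_nhds hb2')
  have e4 : ∀ᶠ b in nhdsWithin (0:ℝ) (Ioi 0),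
      2 * p * Real.tan (2 * b) * (4 / 3) < (1 / 2) ^ (2 * p + 1) * (3 / 5) := by
    refine Filter.Eventually.filter_mono nhdsWithin_le_nhds ?_
    have hc : ContinuousAt (fun b : ℝ => 2 * p * Real.tan (2 * b) * (4 / 3)) 0 := by
      have : ContinuousAt Real.tan (2 * 0) := Real.continuousAt_tan.mpr (by simp)
      have : ContinuousAt (fun b : ℝ => Real.tan (2 * b)) 0 :=
        ContinuousAt.comp (f := fun b : ℝ => 2 * b) this (by fun_prop)
      fun_prop
    refine hc.eventually_lt continuousAt_const ?_
    simp only [mul_zero, Real.tan_zero, zero_mul]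
    positivity
  obtain ⟨b1, ⟨h3, h4⟩, h5⟩ := ((e3.and e4).and self_mem_nhdsWithin).exists
  refine ⟨b1, Real.arccos δ / 2, δ, K, h5, h3.le, hb2, h4, hcos, h2a.le, hK, h2b, ?_⟩
  have h6 : 256 / 27 / K < Real.log (1 / 2) - Real.log δ := by linarith
  rw [div_lt_iff₀ hK0] at h6
  linarith

lemma shooting {p : ℕ} (hp : 1 ≤ p) : ∃ c > 0, ∃ ε > 0, ∀ H : ℝ, |H| < ε →
    ∃ (b T : ℝ) (x y a : ℝ → ℝ), 0 < b ∧ b < Real.pi / 4 ∧ Sol p c H x y a ∧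
      Arc p c H b x y a T ∧ y T = 0 ∧ a T = Real.pi / 2 := by
  obtain ⟨b1, b2, δ, K, hb1, hb12, hb2, hs, hcos, hδ4, hK, hδK, hlog⟩ := constants hp
  obtain ⟨c, hc, ε0, hε0, hexit⟩ := exit_lemma hp hb1 hb12 hb2
  obtain ⟨x1, y1, a1, hS1, hx1, hy1, ha1⟩ := Sol.exists p hc 0 0 (-b1) 0
  obtain ⟨x2, y2, a2, hS2, hx2, hy2, ha2⟩ := Sol.exists p hc 0 0 (-b2) 0
  have u1 : U1 y1 a1 := by
    obtain ⟨T, A, h⟩ := hexit 0 b1 (by simpa using hε0.le) le_rfl hb12 x1 y1 a1 hS1 hx1 hy1 ha1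
    have ne := claim1 hp A hb1 (by linarith) hs
    have TT : T ∈ Icc 0 T := ⟨A.pos.le, le_rfl⟩
    refine arcU1 hS1 A (h.resolve_right ne) (lt_of_le_of_ne (A.ha' T TT) ne)
  have u2 : U2 y2 a2 := by
    obtain ⟨T, A, h⟩ := hexit 0 b2 (by simpa using hε0.le) hb12 le_rfl x2 y2 a2 hS2 hx2 hy2 ha2
    have ne := claim2 hp A (by linarith) hb2 hcos hδ4 hK hδK hlog
    have TT : T ∈ Icc 0 T := ⟨A.pos.le, le_rfl⟩
    refine arcU2 hS2 A (lt_of_le_of_ne (A.hy T TT) ne) (h.resolve_left ne)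
  obtain ⟨δ1, hδ1, P1⟩ := persist1 hc hS1 u1
  obtain ⟨δ2, hδ2, P2⟩ := persist2 hc hS2 u2
  refine ⟨c, hc, min ε0 (min δ1 δ2), lt_min hε0 (lt_min hδ1 hδ2), fun H hH => ?_⟩
  have hH0 : |H| ≤ ε0 := (hH.trans_le (min_le_left _ _)).le
  have hH1 : |H - 0| ≤ δ1 := by
    rw [sub_zero]; exact (hH.trans_le ((min_le_right _ _).trans (min_le_left _ _))).le
  have hH2 : |H - 0| ≤ δ2 := by
    rw [sub_zero]; exact (hH.trans_le ((min_le_right _ _).trans (min_le_right _ _))).le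
  have hex : ∀ b : ℝ, ∃ x y a, Sol p c H x y a ∧ x 0 = 0 ∧ y 0 = -b ∧ a 0 = 0 :=
    fun b => Sol.exists p hc H 0 (-b) 0
  choose X Y Z hS hX hY hZ using hex
  have o1 : IsOpen {b | U1 (Y b) (Z b)} := by
    rw [Metric.isOpen_iff]
    intro b hb
    obtain ⟨d, hd, P⟩ := persist1 hc (hS b) hb
    refine ⟨d, hd, fun b' hb' => P H _ _ _ (hS b') (by simpa using hd.le) (by rw [hX, hX]) ?_
      (by rw [hZ, hZ])⟩
    rw [Metric.mem_ball, Real.dist_eq] at hb'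
    rw [hY, hY, show -b - -b' = b' - b by ring]
    exact hb'.le
  have o2 : IsOpen {b | U2 (Y b) (Z b)} := by
    rw [Metric.isOpen_iff]
    intro b hb
    obtain ⟨d, hd, P⟩ := persist2 hc (hS b) hb
    refine ⟨d, hd, fun b' hb' => P H _ _ _ (hS b') (by simpa using hd.le) (by rw [hX, hX]) ?_
      (by rw [hZ, hZ])⟩
    rw [Metric.mem_ball, Real.dist_eq] at hb'
    rw [hY, hY, show -b - -b' = b' - b by ring]
    exact hb'.le
  have m1 : U1 (Y b1) (Z b1) := P1 H _ _ _ (hS b1) hH1 (by rw [hx1, hX])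
    (by rw [hy1, hY]; simpa using hδ1.le) (by rw [ha1, hZ])
  have m2 : U2 (Y b2) (Z b2) := P2 H _ _ _ (hS b2) hH2 (by rw [hx2, hX])
    (by rw [hy2, hY]; simpa using hδ2.le) (by rw [ha2, hZ])
  have : ¬ Icc b1 b2 ⊆ {b | U1 (Y b) (Z b)} ∪ {b | U2 (Y b) (Z b)} := by
    intro hsub
    obtain ⟨b, _, hb1, hb2⟩ := isPreconnected_Icc _ _ o1 o2 hsub ⟨b1, ⟨le_rfl, hb12⟩, m1⟩
      ⟨b2, ⟨hb12, le_rfl⟩, m2⟩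
    exact U_disj hb1 hb2
  rw [not_subset] at this
  obtain ⟨b, hb, hnot⟩ := this
  obtain ⟨T, A, h⟩ := hexit H b hH0 hb.1 hb.2 _ _ _ (hS b) (hX b) (hY b) (hZ b)
  have TT : T ∈ Icc 0 T := ⟨A.pos.le, le_rfl⟩
  have n1 : ¬ U1 (Y b) (Z b) := fun h => hnot (Or.inl h)
  have n2 : ¬ U2 (Y b) (Z b) := fun h => hnot (Or.inr h)
  have hcorner : Y b T = 0 ∧ Z b T = Real.pi / 2 := by
    rcases h with h | h
    · refine ⟨h, ?_⟩
      by_contra hne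
      exact n1 (arcU1 (hS b) A h (lt_of_le_of_ne (A.ha' T TT) hne))
    · refine ⟨?_, h⟩
      by_contra hne
      exact n2 (arcU2 (hS b) A (lt_of_le_of_ne (A.hy T TT) hne) h)
  exact ⟨b, T, X b, Y b, Z b, hb1.trans_le hb.1, hb.2.trans_lt hb2, hS b, A, hcorner.1, hcorner.2⟩
/-! ### Part E: closing up the arc by reflections -/

/-- a global honest periodic simple solution in centred coordinates -/
structure Glob (p : ℕ) (H : ℝ) (x y a : ℝ → ℝ) (L : ℝ) : Prop where
  pos : 0 < L
  dx : ∀ s, HasDerivAt x (Real.cos (a s)) s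
  dy : ∀ s, HasDerivAt y (Real.sin (a s) / Real.cos (x s)) s
  da : ∀ s, HasDerivAt a (aT p H (x s) (y s) (a s)) s
  hx : ∀ s, -(Real.pi / 2) < x s ∧ x s < Real.pi / 2
  hy : ∀ s, -(Real.pi / 4) < y s ∧ y s < Real.pi / 4
  px : Function.Periodic x L
  py : Function.Periodic y L
  inj : InjOn (fun s => (x s, y s)) (Ico 0 L)

lemma Sol.refl1 {p : ℕ} {c H : ℝ} {x y a : ℝ → ℝ} (h : Sol p c H x y a) :
    Sol p c H (fun s => -x (-s)) (fun s => y (-s)) (fun s => -a (-s)) := by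
  refine ⟨fun s => ?_, fun s => ?_, fun s => ?_⟩
  · refine ((h.dx (-s)).comp s (hasDerivAt_neg s)).neg.congr_deriv ?_
    rw [Real.cos_neg]; ring
  · refine ((h.dy (-s)).comp s (hasDerivAt_neg s)).congr_deriv ?_
    rw [Real.sin_neg, Real.cos_neg]; ring
  · refine ((h.da (-s)).comp s (hasDerivAt_neg s)).neg.congr_deriv ?_
    unfold aR
    rw [Real.sin_neg, Real.cos_neg, Real.sin_neg, Real.cos_neg]; ring

lemma Sol.refl2 {p : ℕ} {c H : ℝ} {x y a : ℝ → ℝ} (h : Sol p c H x y a) (T : ℝ) :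
    Sol p c H (fun s => x (2 * T - s)) (fun s => -y (2 * T - s))
      (fun s => Real.pi - a (2 * T - s)) := by
  have hd : ∀ s : ℝ, HasDerivAt (fun s => 2 * T - s) (-1) s := fun s =>
    (hasDerivAt_id s).const_sub (2 * T)
  refine ⟨fun s => ?_, fun s => ?_, fun s => ?_⟩
  · refine ((h.dx (2 * T - s)).comp s (hd s)).congr_deriv ?_
    rw [Real.cos_pi_sub]; ring
  · refine ((h.dy (2 * T - s)).comp s (hd s)).neg.congr_deriv ?_
    rw [Real.sin_pi_sub]; ring
  · refine (((h.da (2 * T - s)).comp s (hd s)).const_sub Real.pi).congr_deriv ?_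
    unfold aR
    rw [Real.sin_pi_sub, Real.cos_pi_sub,
      show (2 : ℝ) * -y (2 * T - s) = -(2 * y (2 * T - s)) by ring, Real.sin_neg, Real.cos_neg]
    ring

/-- the closed loop, together with the facts used to distinguish two loops -/
structure Loop (p : ℕ) (H b T : ℝ) (x y a : ℝ → ℝ) : Prop where
  glob : Glob p H x y a (4 * T)
  Tpos : 0 < T
  x0 : x 0 = 0
  y0 : y 0 = -b
  a0 : a 0 = 0
  ybd : ∀ s, -b ≤ y s
  xneg : ∀ s, x (-s) = -x s
  yneg : ∀ s, y (-s) = y s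
  xpos : ∀ s ∈ Ioo 0 (2 * T), 0 < x s
  xnonpos : ∀ s ∈ Ico (2 * T) (4 * T), x s ≤ 0
  ysm : ∀ s t, 0 ≤ s → s < t → t ≤ 2 * T → y s < y t

lemma make_loop {p : ℕ} {c H b T : ℝ} (hc : 0 < c) (hb : b < Real.pi / 4) {x y a : ℝ → ℝ}
    (hS : Sol p c H x y a) (A : Arc p c H b x y a T) (hyT : y T = 0) (haT : a T = Real.pi / 2) :
    Loop p H b T x y a := by
  have TT : T ∈ Icc 0 T := ⟨A.pos.le, le_rfl⟩
  have T0 := A.pos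
  have R1 : ∀ s, x s = -x (-s) ∧ y s = y (-s) ∧ a s = -a (-s) :=
    Sol.unique hc hS hS.refl1 0 (by simp [A.x0]) (by simp) (by simp [A.a0])
  have R2 : ∀ s, x s = x (2 * T - s) ∧ y s = -y (2 * T - s) ∧ a s = Real.pi - a (2 * T - s) :=
    Sol.unique hc hS (hS.refl2 T) T (by simp [two_mul]) (by simp [two_mul, hyT])
      (by simp only [two_mul, add_sub_cancel_right, haT]; ring)
  have hx2 : ∀ s, x (s + 2 * T) = -x s := by
    intro s
    rw [(R2 (s + 2 * T)).1, (R1 s).1]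
    congr 1; rw [neg_neg]; congr 1; ring
  have hy2 : ∀ s, y (s + 2 * T) = -y s := by
    intro s
    rw [(R2 (s + 2 * T)).2.1, (R1 s).2.1]
    congr 2; ring
  have px : Function.Periodic x (4 * T) := by
    intro s
    rw [show s + 4 * T = s + 2 * T + 2 * T by ring, hx2, hx2, neg_neg]
  have py : Function.Periodic y (4 * T) := by
    intro s
    rw [show s + 4 * T = s + 2 * T + 2 * T by ring, hy2, hy2, neg_neg]
  have L0 : 0 < 4 * T := by linarith
  -- bounds
  have B2 : ∀ s ∈ Icc 0 (2 * T), (0 ≤ x s ∧ x s < Real.pi / 2) ∧ (-b ≤ y s ∧ y s ≤ b) ∧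
      c ≤ Real.cos (x s) ∧ c ≤ Real.cos (2 * y s) := by
    intro s hs
    rcases le_total s T with h | h
    · have hs' : s ∈ Icc 0 T := ⟨hs.1, h⟩
      have := A.hyb s hs'
      have := A.hy s hs'
      have := A.hyb 0 ⟨le_rfl, A.pos.le⟩
      exact ⟨⟨A.hx s hs', A.hx' s hs'⟩, ⟨A.hyb s hs', by linarith [A.hyb s hs', A.hy s hs']⟩,
        A.hcx s hs', A.hcy s hs'⟩
    · have hs' : 2 * T - s ∈ Icc 0 T := ⟨by linarith [hs.2], by linarith⟩
      have h1 := A.hyb _ hs'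
      have h2 := A.hy _ hs'
      rw [(R2 s).1, (R2 s).2.1]
      refine ⟨⟨A.hx _ hs', A.hx' _ hs'⟩, ⟨by linarith, by linarith⟩, A.hcx _ hs', ?_⟩
      rw [mul_neg, Real.cos_neg]
      exact A.hcy _ hs'
  have B4 : ∀ s ∈ Ico 0 (4 * T), (-(Real.pi / 2) < x s ∧ x s < Real.pi / 2) ∧
      (-b ≤ y s ∧ y s ≤ b) ∧ c ≤ Real.cos (x s) ∧ c ≤ Real.cos (2 * y s) := by
    intro s hs
    have := Real.pi_pos
    rcases le_total s (2 * T) with h | h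
    · obtain ⟨h1, h2, h3⟩ := B2 s ⟨hs.1, h⟩
      exact ⟨⟨by linarith, h1.2⟩, h2, h3⟩
    · obtain ⟨h1, h2, h3, h4⟩ := B2 (s - 2 * T) ⟨by linarith, by linarith [hs.2]⟩
      have e1 := hx2 (s - 2 * T)
      have e2 := hy2 (s - 2 * T)
      rw [sub_add_cancel] at e1 e2
      rw [e1, e2, mul_neg, Real.cos_neg, Real.cos_neg]
      exact ⟨⟨by linarith, by linarith⟩, ⟨by linarith, by linarith⟩, h3, h4⟩
  have B : ∀ s, (-(Real.pi / 2) < x s ∧ x s < Real.pi / 2) ∧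
      (-b ≤ y s ∧ y s ≤ b) ∧ c ≤ Real.cos (x s) ∧ c ≤ Real.cos (2 * y s) := by
    intro s
    have pp : Function.Periodic (fun s => (x s, y s)) (4 * T) := fun s => by
      simp only [px s, py s]
    obtain ⟨t, ht, h⟩ := pp.exists_mem_Ico₀ L0 s
    simp only [Prod.mk.injEq] at h
    rw [h.1, h.2]
    exact B4 t ht
  have asm : ∀ s ∈ Ico 0 T, a s < Real.pi / 2 := by
    intro s hs
    rw [← haT]
    exact strict_hd hs.2 (fun u hu => A.da u (sub_Icc hs.1 le_rfl u hu))
      (fun u hu => A.hda u (sub_Icc hs.1 le_rfl u ⟨hu.1.le, hu.2.le⟩))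
  have xp1 : ∀ s ∈ Ioc 0 T, 0 < x s := by
    intro s hs
    rw [← A.x0]
    refine strict_hd hs.1 (fun u _ => hS.dx u) (fun u hu => ?_)
    have hu' : u ∈ Ico 0 T := ⟨hu.1.le, hu.2.trans_le hs.2⟩
    have := Real.pi_pos
    exact Real.cos_pos_of_mem_Ioo ⟨by linarith [A.ann u ⟨hu'.1, hu'.2.le⟩], asm u hu'⟩
  have xpos : ∀ s ∈ Ioo 0 (2 * T), 0 < x s := by
    intro s hs
    rcases le_total s T with h | h
    · exact xp1 s ⟨hs.1, h⟩
    · rw [(R2 s).1]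
      exact xp1 _ ⟨by linarith [hs.2], by linarith⟩
  have xneg' : ∀ s ∈ Ioo (2 * T) (4 * T), x s < 0 := by
    intro s hs
    have e1 := hx2 (s - 2 * T)
    rw [sub_add_cancel] at e1
    rw [e1]
    linarith [xpos (s - 2 * T) ⟨by linarith [hs.1], by linarith [hs.2]⟩]
  have x2T : x (2 * T) = 0 := by
    have := hx2 0
    rwa [zero_add, A.x0, neg_zero] at this
  have ysm : ∀ s t, 0 ≤ s → s < t → t ≤ 2 * T → y s < y t := by
    have key : ∀ s t, T ≤ s → s < t → t ≤ 2 * T → y s < y t := by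
      intro s t h1 h2 h3
      rw [(R2 s).2.1, (R2 t).2.1]
      have := A.ysmono (s := 2 * T - t) (t := 2 * T - s) (by linarith) (by linarith) (by linarith)
      linarith
    intro s t h1 h2 h3
    rcases le_total t T with h | h
    · exact A.ysmono h1 h2 h
    · rcases le_total T s with h' | h'
      · exact key s t h' h2 h3
      · rcases h.eq_or_lt with e | e
        · rw [← e]
          exact A.ysmono h1 (by rw [e]; exact h2) le_rfl
        · refine lt_of_le_of_lt ?_ (key T t le_rfl e h3)
          exact A.ymono h1 h' le_rfl
  have inj : InjOn (fun s => (x s, y s)) (Ico 0 (4 * T)) := by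
    have key : ∀ s ∈ Ico 0 (4 * T), ∀ t ∈ Ico 0 (4 * T), s < t → (x s, y s) = (x t, y t) →
        False := by
      intro s hs t ht hst he
      simp only [Prod.mk.injEq] at he
      rcases le_or_gt t (2 * T) with h | h
      · exact (ysm s t hs.1 hst h).ne he.2
      · have h1 := xneg' t ⟨h, ht.2⟩
        rcases le_or_gt (2 * T) s with h' | h'
        · have e1 := hy2 (s - 2 * T)
          have e2 := hy2 (t - 2 * T)
          rw [sub_add_cancel] at e1 e2
          have := ysm (s - 2 * T) (t - 2 * T) (by linarith) (by linarith) (by linarith [ht.2])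
          linarith [he.2]
        · have := (B2 s ⟨hs.1, h'.le⟩).1.1
          linarith [he.1]
    intro s hs t ht he
    rcases lt_trichotomy s t with h | h | h
    · exact (key s hs t ht h he).elim
    · exact h
    · exact (key t ht s hs h he.symm).elim
  refine ⟨⟨L0, hS.dx, fun s => ?_, fun s => ?_, fun s => (B s).1, fun s => ?_, px, py, inj⟩, A.pos,
    A.x0, A.y0, A.a0, fun s => (B s).2.1.1, fun s => ?_, fun s => (R1 s).2.1.symm, xpos, ?_, ysm⟩
  · have := hS.dy s
    rwa [max_eq_left (B s).2.2.1, ← div_eq_mul_inv] at this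
  · have := hS.da s
    rwa [aR_eq (B s).2.2.1 (B s).2.2.2] at this
  · have := (B s).2.1
    exact ⟨by linarith, by linarith⟩
  · rw [(R1 s).1, neg_neg]
  · intro s hs
    rcases hs.1.eq_or_lt with h | h
    · rw [← h, x2T]
    · exact (xneg' s ⟨h, hs.2⟩).le

lemma Glob.cosx {p : ℕ} {H L : ℝ} {x y a : ℝ → ℝ} (h : Glob p H x y a L) (s : ℝ) :
    0 < Real.cos (x s) := Real.cos_pos_of_mem_Ioo (h.hx s)

lemma Glob.cosy {p : ℕ} {H L : ℝ} {x y a : ℝ → ℝ} (h : Glob p H x y a L) (s : ℝ) :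
    0 < Real.cos (2 * y s) :=
  Real.cos_pos_of_mem_Ioo ⟨by linarith [(h.hy s).1], by linarith [(h.hy s).2]⟩

/-- reflection in the first coordinate -/
lemma Glob.reflect {p : ℕ} {H L : ℝ} {x y a : ℝ → ℝ} (h : Glob p H x y a L) :
    Glob p (-H) (fun s => -x s) y (fun s => Real.pi - a s) L := by
  refine ⟨h.pos, fun s => ?_, fun s => ?_, fun s => ?_, fun s => ?_, h.hy, fun s => ?_, h.py, ?_⟩
  · refine (h.dx s).neg.congr_deriv ?_
    rw [Real.cos_pi_sub]
  · refine (h.dy s).congr_deriv ?_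
    rw [Real.sin_pi_sub, Real.cos_neg]
  · refine ((h.da s).const_sub Real.pi).congr_deriv ?_
    unfold aT
    rw [Real.sin_pi_sub, Real.cos_pi_sub, Real.sin_neg, Real.cos_neg]; ring
  · exact ⟨by linarith [(h.hx s).2], by linarith [(h.hx s).1]⟩
  · simp only [h.px s]
  · intro s hs t ht he
    simp only [Prod.mk.injEq, neg_inj] at he
    exact h.inj hs ht (Prod.ext he.1 he.2)

lemma Glob.smooth {p : ℕ} {H L : ℝ} {x y a : ℝ → ℝ} (h : Glob p H x y a L) :
    ContDiff ℝ (⊤ : ℕ∞) x ∧ ContDiff ℝ (⊤ : ℕ∞) y ∧ ContDiff ℝ (⊤ : ℕ∞) a := by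
  have ex : deriv x = fun s => Real.cos (a s) := funext fun s => (h.dx s).deriv
  have ey : deriv y = fun s => Real.sin (a s) / Real.cos (x s) := funext fun s => (h.dy s).deriv
  have ea : deriv a = fun s => aT p H (x s) (y s) (a s) := funext fun s => (h.da s).deriv
  have key : ∀ n : ℕ, ContDiff ℝ n x ∧ ContDiff ℝ n y ∧ ContDiff ℝ n a := by
    intro n
    induction n with
    | zero =>
      refine ⟨?_, ?_, ?_⟩ <;> simp only [Nat.cast_zero, contDiff_zero] <;>
        refine continuous_iff_continuousAt.mpr fun s => ?_
      · exact (h.dx s).continuousAt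
      · exact (h.dy s).continuousAt
      · exact (h.da s).continuousAt
    | succ n ih =>
      obtain ⟨i1, i2, i3⟩ := ih
      have cx : ContDiff ℝ n fun s => Real.cos (x s) := Real.contDiff_cos.comp i1
      have sx : ContDiff ℝ n fun s => Real.sin (x s) := Real.contDiff_sin.comp i1
      have ca : ContDiff ℝ n fun s => Real.cos (a s) := Real.contDiff_cos.comp i3
      have sa : ContDiff ℝ n fun s => Real.sin (a s) := Real.contDiff_sin.comp i3
      have y2 : ContDiff ℝ n fun s => 2 * y s := contDiff_const.mul i2
      have cy : ContDiff ℝ n fun s => Real.cos (2 * y s) := Real.contDiff_cos.comp y2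
      have sy : ContDiff ℝ n fun s => Real.sin (2 * y s) := Real.contDiff_sin.comp y2
      have nx := fun s => (h.cosx s).ne'
      have ny := fun s => (h.cosy s).ne'
      refine ⟨?_, ?_, ?_⟩ <;> push_cast <;> rw [contDiff_succ_iff_deriv]
      · exact ⟨fun s => (h.dx s).differentiableAt, by simp, by rw [ex]; exact ca⟩
      · exact ⟨fun s => (h.dy s).differentiableAt, by simp, by rw [ey]; exact sa.div cx nx⟩
      · refine ⟨fun s => (h.da s).differentiableAt, by simp, ?_⟩
        rw [ea]
        unfold aT
        exact (((contDiff_const.mul (sy.div cy ny)).mul (ca.div cx nx)).add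
          ((contDiff_const.mul (sx.div cx nx)).mul sa)).add contDiff_const
  exact ⟨contDiff_infty.mpr fun n => (key n).1, contDiff_infty.mpr fun n => (key n).2.1,
    contDiff_infty.mpr fun n => (key n).2.2⟩

/-- first-order comparison with a parabola at the bottom of the loop -/
lemma Loop.local {p : ℕ} {H b T : ℝ} {x y a : ℝ → ℝ} (h : Loop p H b T x y a) {k σ : ℝ}
    (hk : 0 < σ * (aT p H 0 (-b) 0 - 2 * k)) :
    ∃ δ > 0, ∀ s ∈ Ioo 0 δ, 0 < σ * (y s + b - k * x s ^ 2) := by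
  have G := h.glob
  have dD : ∀ s, HasDerivAt (fun s => σ * (y s + b - k * x s ^ 2))
      (σ * (Real.sin (a s) / Real.cos (x s) - 2 * k * (x s * Real.cos (a s)))) s := by
    intro s
    refine ((((G.dy s).add_const b).sub (((G.dx s).pow 2).const_mul k)).const_mul σ).congr_deriv ?_
    simp only [Nat.cast_ofNat]
    ring
  have dg : HasDerivAt (fun s => σ * (Real.sin (a s) / Real.cos (x s)
      - 2 * k * (x s * Real.cos (a s)))) (σ * (aT p H 0 (-b) 0 - 2 * k)) 0 := by
    have d1 := (G.da 0).sin.div (G.dx 0).cos (G.cosx 0).ne'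
    have d2 := ((G.dx 0).mul (G.da 0).cos).const_mul (2 * k)
    refine ((d1.sub d2).const_mul σ).congr_deriv ?_
    simp only [h.x0, h.y0, h.a0, Real.sin_zero, Real.cos_zero]
    ring
  have e := pos_right dg hk
  simp only [h.x0, h.a0, Real.sin_zero, zero_div, zero_mul, mul_zero, sub_zero] at e
  obtain ⟨δ, hδ, hsub⟩ := mem_nhdsGT_iff_exists_Ioo_subset.mp e
  refine ⟨δ, hδ, fun s hs => ?_⟩
  have := strict_hd hs.1 (fun u _ => dD u) (fun u hu => hsub ⟨hu.1, hu.2.trans hs.2⟩)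
  simp only [h.x0, h.y0] at this
  have e0 : σ * (-b + b - k * 0 ^ 2) = 0 := by ring
  linarith

/-- two loops with different mean curvature have different images -/
lemma Loop.distinct {p : ℕ} {H b T H' b' T' : ℝ} {x y a x' y' a' : ℝ → ℝ}
    (h : Loop p H b T x y a) (h' : Loop p H' b' T' x' y' a') (hH : H < H') :
    range (fun s => (x s, y s)) ≠ range (fun s => (x' s, y' s)) := by
  intro he
  have hbb : b = b' := by
    apply le_antisymm
    · have : (x 0, y 0) ∈ range (fun s => (x' s, y' s)) := by rw [← he]; exact ⟨0, rfl⟩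
      obtain ⟨t, ht⟩ := this
      simp only [Prod.mk.injEq] at ht
      have := h'.ybd t
      rw [ht.2, h.y0] at this
      linarith
    · have : (x' 0, y' 0) ∈ range (fun s => (x s, y s)) := by rw [he]; exact ⟨0, rfl⟩
      obtain ⟨t, ht⟩ := this
      simp only [Prod.mk.injEq] at ht
      have := h.ybd t
      rw [ht.2, h'.y0] at this
      linarith
  subst hbb
  have hd : aT p H' 0 (-b) 0 = aT p H 0 (-b) 0 + (H' - H) := by unfold aT; ring
  obtain ⟨k, hk⟩ : ∃ k, 2 * k = aT p H 0 (-b) 0 + (H' - H) / 2 :=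
    ⟨(aT p H 0 (-b) 0 + (H' - H) / 2) / 2, by ring⟩
  obtain ⟨δ, hδ, h1⟩ := h.local (k := k) (σ := -1) (by linarith)
  obtain ⟨δ', hδ', h2⟩ := h'.local (k := k) (σ := 1) (by linarith)
  have hT := h.Tpos
  have hT' := h'.Tpos
  obtain ⟨v, hv⟩ : ∃ v, v = min (δ' / 2) (2 * T') := ⟨_, rfl⟩
  have v0 : 0 < v := by rw [hv]; exact lt_min (by linarith) (by linarith)
  have v1 : v < δ' := by rw [hv]; exact (min_le_left _ _).trans_lt (by linarith)
  have v2 : v ≤ 2 * T' := by rw [hv]; exact min_le_right _ _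
  have yv : y 0 < y' v := by
    rw [h.y0, ← h'.y0]; exact h'.ysm 0 v le_rfl v0 v2
  have e1 : ∀ᶠ s in nhdsWithin (0:ℝ) (Ioi 0), y s < y' v :=
    ((h.glob.dy 0).continuousAt.continuousWithinAt).eventually_lt continuousWithinAt_const yv
  obtain ⟨s, ⟨hs1, hs2⟩, hs3⟩ := ((e1.and (Ioo_mem_nhdsGT hδ)).and
    (Ioo_mem_nhdsGT (by linarith : (0:ℝ) < 2 * T))).exists
  have xs := h.xpos s hs3
  have : (x s, y s) ∈ range (fun s => (x' s, y' s)) := by rw [← he]; exact ⟨s, rfl⟩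
  obtain ⟨t₀, ht₀⟩ := this
  have pp : Function.Periodic (fun s => (x' s, y' s)) (4 * T') := fun s => by
    simp only [h'.glob.px s, h'.glob.py s]
  obtain ⟨t, ht, htt⟩ := pp.exists_mem_Ico₀ h'.glob.pos t₀
  replace htt := ht₀.symm.trans htt
  simp only [Prod.mk.injEq] at htt
  have t0 : 0 < t := by
    rcases ht.1.eq_or_lt with e | e
    · rw [← e, h'.x0] at htt; linarith [htt.1]
    · exact e
  have t2 : t < 2 * T' := by
    by_contra hcon
    push Not at hcon
    have := h'.xnonpos t ⟨hcon, ht.2⟩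
    linarith [htt.1]
  have tv : t < v := by
    by_contra hcon
    push Not at hcon
    rcases hcon.eq_or_lt with e | e
    · rw [← e] at htt; linarith [htt.2]
    · have := h'.ysm v t v0.le e t2.le
      linarith [htt.2]
  have q1 := h1 s hs2
  have q2 := h2 t ⟨t0, tv.trans v1⟩
  rw [htt.1, htt.2] at q1
  linarith

lemma Glob.result {p : ℕ} {H L : ℝ} {x y a : ℝ → ℝ} (h : Glob p H x y a L) :
    ContDiff ℝ (⊤ : ℕ∞) (fun s => x s + Real.pi / 2) ∧
    ContDiff ℝ (⊤ : ℕ∞) (fun s => y s + Real.pi / 4) ∧ ContDiff ℝ (⊤ : ℕ∞) a ∧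
    IsCMCSolutionOn (p + 1) H (fun s => x s + Real.pi / 2) (fun s => y s + Real.pi / 4) a univ ∧
    (∀ s : ℝ, x s + Real.pi / 2 ∈ Ioo 0 Real.pi ∧ y s + Real.pi / 4 ∈ Ioo 0 (Real.pi / 2)) ∧
    Function.Periodic (fun s => x s + Real.pi / 2) L ∧
    Function.Periodic (fun s => y s + Real.pi / 4) L ∧
    InjOn (fun s => (x s + Real.pi / 2, y s + Real.pi / 4)) (Ico 0 L) := by
  obtain ⟨sx, sy, sa⟩ := h.smooth
  refine ⟨sx.add contDiff_const, sy.add contDiff_const, sa, ?_, ?_, ?_, ?_, ?_⟩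
  · intro s _
    have cx := h.cosx s
    have cy := h.cosy s
    have e2 : 2 * (y s + Real.pi / 4) = 2 * y s + Real.pi / 2 := by ring
    refine ⟨?_, ?_, ?_, ?_, ?_⟩
    · simp only [Real.sin_add_pi_div_two]; exact cx.ne'
    · simp only [e2, Real.sin_add_pi_div_two]; exact cy.ne'
    · exact ((h.dx s).add_const _).hasDerivWithinAt
    · simp only [Real.sin_add_pi_div_two]
      exact ((h.dy s).add_const _).hasDerivWithinAt
    · refine ((h.da s).congr_deriv ?_).hasDerivWithinAt
      unfold aT alphaRHS
      simp only [e2, Real.sin_add_pi_div_two, Real.cos_add_pi_div_two]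
      push_cast
      ring
  · intro s
    have h1 := h.hx s
    have h2 := h.hy s
    exact ⟨⟨by linarith [h1.1], by linarith [h1.2]⟩, ⟨by linarith [h2.1], by linarith [h2.2]⟩⟩
  · intro s
    simp only [h.px s]
  · intro s
    simp only [h.py s]
  · intro s hs t ht hst
    simp only [Prod.mk.injEq, add_left_inj] at hst
    exact h.inj hs ht (Prod.ext hst.1 hst.2)

/-- Main theorem (ODE formulation): for every `n ≥ 2` there is `ε > 0` such that for every
`−ε < H < 0` there are two smooth global solutions of the CMC profile ODE system with
parameter `H`, whose profile curves `s ↦ (rᵢ(s), θᵢ(s))` lie in `(0, π) × (0, π/2)`, are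
periodic and simple, and have distinct images — yielding two non-isometric CMC embeddings
of `S^{n−1} × S^{n−1} × S¹` in `S^{2n}(1)` with the same mean curvature `H`. -/
theorem two_cmc_embeddings (n : ℕ) (hn : 2 ≤ n) :
    ∃ ε > (0 : ℝ), ∀ H : ℝ, -ε < H → H < 0 →
      ∃ (r₁ θ₁ α₁ r₂ θ₂ α₂ : ℝ → ℝ) (L₁ L₂ : ℝ),
        0 < L₁ ∧ 0 < L₂ ∧
        ContDiff ℝ (⊤ : ℕ∞) r₁ ∧ ContDiff ℝ (⊤ : ℕ∞) θ₁ ∧ ContDiff ℝ (⊤ : ℕ∞) α₁ ∧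
        ContDiff ℝ (⊤ : ℕ∞) r₂ ∧ ContDiff ℝ (⊤ : ℕ∞) θ₂ ∧ ContDiff ℝ (⊤ : ℕ∞) α₂ ∧
        IsCMCSolutionOn n H r₁ θ₁ α₁ univ ∧
        IsCMCSolutionOn n H r₂ θ₂ α₂ univ ∧
        (∀ s : ℝ, r₁ s ∈ Ioo 0 Real.pi ∧ θ₁ s ∈ Ioo 0 (Real.pi / 2)) ∧
        (∀ s : ℝ, r₂ s ∈ Ioo 0 Real.pi ∧ θ₂ s ∈ Ioo 0 (Real.pi / 2)) ∧
        Function.Periodic r₁ L₁ ∧ Function.Periodic θ₁ L₁ ∧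
        Function.Periodic r₂ L₂ ∧ Function.Periodic θ₂ L₂ ∧
        InjOn (fun s => (r₁ s, θ₁ s)) (Ico 0 L₁) ∧
        InjOn (fun s => (r₂ s, θ₂ s)) (Ico 0 L₂) ∧
        range (fun s => (r₁ s, θ₁ s)) ≠ range (fun s => (r₂ s, θ₂ s)) := by
  obtain ⟨p, rfl⟩ : ∃ p, n = p + 1 := ⟨n - 1, by omega⟩
  have hp : 1 ≤ p := by omega
  obtain ⟨c, hc, ε, hε, hsh⟩ := shooting hp
  refine ⟨ε, hε, fun H hH1 hH2 => ?_⟩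
  obtain ⟨b, T, x, y, a, hb0, hb, hS, A, hyT, haT⟩ := hsh H (abs_lt.2 ⟨hH1, by linarith⟩)
  obtain ⟨b', T', x', y', a', hb0', hb', hS', A', hyT', haT'⟩ :=
    hsh (-H) (abs_lt.2 ⟨by linarith, by linarith⟩)
  have l1 := make_loop hc hb hS A hyT haT
  have l2 := make_loop hc hb' hS' A' hyT' haT'
  have hne := l1.distinct l2 (by linarith)
  have g2 := l2.glob.reflect
  rw [neg_neg] at g2
  obtain ⟨p1, p2, p3, p4, p5, p6, p7, p8⟩ := l1.glob.result
  obtain ⟨q1, q2, q3, q4, q5, q6, q7, q8⟩ := g2.result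
  refine ⟨_, _, _, _, _, _, _, _, l1.glob.pos, g2.pos, p1, p2, p3, q1, q2, q3, p4, q4, p5, q5,
    p6, p7, q6, q7, p8, q8, fun he => hne ?_⟩
  ext ⟨u, v⟩
  have hm : ∀ w : ℝ × ℝ, (w ∈ range fun s => (x s + Real.pi / 2, y s + Real.pi / 4)) ↔
      w ∈ range fun s => (-x' s + Real.pi / 2, y' s + Real.pi / 4) := fun w => by rw [he]
  have hw := hm (u + Real.pi / 2, v + Real.pi / 4)
  simp only [mem_range, Prod.mk.injEq, add_left_inj] at hw ⊢
  rw [hw]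
  constructor
  · rintro ⟨s, h1, h2⟩
    exact ⟨-s, by rw [l2.xneg]; exact h1, by rw [l2.yneg]; exact h2⟩
  · rintro ⟨s, h1, h2⟩
    exact ⟨-s, by rw [l2.xneg, neg_neg]; exact h1, by rw [l2.yneg]; exact h2⟩
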